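/- Let M^n be a sequence in 𝓜(t,m) whose laws converge for 𝓛(κ₁) to the law of a process M, and let π^n = {t = t^n₁ < ... < t^n_{N_n} = T} be partitions with mesh |π^n| → 0. Then the Riemann sums converge: E[ Σ_{q=1}^{N_n−1} (t^n_{q+1} − t^n_q) H(t^n_q, M^n_{t^n_q}) ] → E[ ∫_t^T H(s, M_s) ds ]. -/

import Mathlib

open MeasureTheory Filter Set
open scoped Topology ENNReal NNReal BoundedContinuousFunction

noncomputable section

/-- Euclidean space `ℝ^d`. -/
abbrev Ed (d : ℕ) : Type := EuclideanSpace ℝ (Fin d)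

/-- `m ∈ 𝒫_p` : Borel probability measure on `ℝ^d` with finite `p`-th moment. -/
def MemP (d : ℕ) (p : ℝ) (m : Measure (Ed d)) : Prop :=
  IsProbabilityMeasure m ∧ Integrable (fun x => ‖x‖ ^ p) m

/-- `γ` is a coupling of `m` and `m'`. -/
def IsCoupling (d : ℕ) (γ : Measure (Ed d × Ed d)) (m m' : Measure (Ed d)) : Prop :=
  γ.map Prod.fst = m ∧ γ.map Prod.snd = m'

/-- The `p`-Wasserstein distance. -/
def wdist (d : ℕ) (p : ℝ) (m m' : Measure (Ed d)) : ℝ :=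
  sInf { c : ℝ | ∃ γ : Measure (Ed d × Ed d), IsProbabilityMeasure γ ∧ IsCoupling d γ m m' ∧
      c = (∫ q, ‖q.1 - q.2‖ ^ p ∂γ) ^ (1 / p) }

/-- The Gaussian kernel `ρ_δ`. -/
def gaussDensity (d : ℕ) (δ : ℝ) (x : Ed d) : ℝ :=
  (2 * Real.pi * δ) ^ (-(d : ℝ) / 2) * Real.exp (-‖x‖ ^ 2 / (2 * δ))

/-- The centered Gaussian measure with variance `δ` on `ℝ^d`. -/
def gaussMeasure (d : ℕ) (δ : ℝ) : Measure (Ed d) :=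
  volume.withDensity fun x => ENNReal.ofReal (gaussDensity d δ x)

/-- The heat flow `p^{t,m}_s` : the law at time `s` of a Brownian motion started
at time `t` with initial law `m`. -/
def heatFlow (d : ℕ) (t s : ℝ) (m : Measure (Ed d)) : Measure (Ed d) :=
  if s ≤ t then m
  else Measure.map (fun q : Ed d × Ed d => q.1 + q.2) (m.prod (gaussMeasure d (s - t)))

/-- The natural filtration of a measure-valued process, made right-continuous:
`𝓕^M_s = ⋂_{u > s} σ(M_r, r ∈ [t,u])`. -/
def genFiltration {Ω : Type} (d : ℕ) (M : ℝ → Ω → Measure (Ed d)) (t s : ℝ) :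
    MeasurableSpace Ω :=
  ⨅ u ∈ Set.Ioi s, ⨆ r ∈ Set.Icc t u, MeasurableSpace.comap (M r) inferInstance

/-- A path `[t,T] → (𝒫₁,d₁)` is càdlàg: right-continuous with left limits (for `d₁`). -/
def CadlagD1 (d : ℕ) (t T : ℝ) (g : ℝ → Measure (Ed d)) : Prop :=
  (∀ s ∈ Set.Ico t T, Tendsto (fun r => wdist d 1 (g r) (g s)) (𝓝[Set.Ici s] s) (𝓝 0)) ∧
  (∀ s ∈ Set.Ioc t T, ∃ μ : Measure (Ed d),
      Tendsto (fun r => wdist d 1 (g r) μ) (𝓝[Set.Ico t s] s) (𝓝 0))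

/-- An element of `𝓜(t,m)` : a càdlàg `(𝒫₁,d₁)`-valued process `M = (M_s)_{s∈[t,T]}`
on some probability space such that (i) `E[M_t(φ)] = m(φ)` for all bounded continuous `φ`
and (ii) `E[M_{t₂}(φ) | 𝓕^M_{t₁}] = p^{t₁,M_{t₁}}_{t₂}(φ)` for all `t ≤ t₁ ≤ t₂ ≤ T` and
all bounded continuous `φ`. -/
structure MVP (d : ℕ) (T t : ℝ) (m : Measure (Ed d)) where
  Ω : Type
  mΩ : MeasurableSpace Ω
  P : @Measure Ω mΩ
  probP : IsProbabilityMeasure P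
  M : ℝ → Ω → Measure (Ed d)
  meas : ∀ s, @Measurable Ω (Measure (Ed d)) mΩ inferInstance (M s)
  inP1 : ∀ s ∈ Set.Icc t T, ∀ ω, MemP d 1 (M s ω)
  cadlag : ∀ ω, CadlagD1 d t T (fun s => M s ω)
  init : ∀ φ : Ed d →ᵇ ℝ, ∫ ω, (∫ x, φ x ∂(M t ω)) ∂P = ∫ x, φ x ∂m
  cond : ∀ t₁ t₂ : ℝ, t ≤ t₁ → t₁ ≤ t₂ → t₂ ≤ T → ∀ φ : Ed d →ᵇ ℝ,
    P[(fun ω => ∫ x, φ x ∂(M t₂ ω)) | genFiltration d M t t₁]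
      =ᵐ[P] fun ω => ∫ x, φ x ∂(heatFlow d t₁ t₂ (M t₁ ω))
/-- A path in `𝔻([t,T],𝒫₁)` : càdlàg with values in `𝒫₁`. -/
def IsD1Path (d : ℕ) (t T : ℝ) (g : ℝ → Measure (Ed d)) : Prop :=
  (∀ s ∈ Set.Icc t T, MemP d 1 (g s)) ∧ CadlagD1 d t T g

/-- The space `𝔻([t,T],𝒫₁)` of càdlàg paths with values in `(𝒫₁,d₁)`. -/
def DPath (d : ℕ) (t T : ℝ) : Type := { g : ℝ → Measure (Ed d) // IsD1Path d t T g }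

/-- The canonical σ-algebra on `𝔻([t,T],𝒫₁)` generated by the coordinate maps. -/
instance instMeasDPath (d : ℕ) (t T : ℝ) : MeasurableSpace (DPath d t T) :=
  ⨆ s ∈ Set.Icc t T, MeasurableSpace.comap (fun g : DPath d t T => g.1 s) inferInstance

/-- A metric for the topology `κ₁` on `𝔻([t,T],𝒫₁)` : convergence in (Lebesgue) measure
of the trajectories together with convergence of the value at `T`. -/
def distD (d : ℕ) (t T : ℝ) (g h : DPath d t T) : ℝ :=
  (∫ s in Set.Icc t T, min 1 (wdist d 1 (g.1 s) (h.1 s))) + min 1 (wdist d 1 (g.1 T) (h.1 T))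

/-- The canonical filtration on `𝔻([t,T],𝒫₁)`, made right-continuous. -/
def canonFiltration (d : ℕ) (t T : ℝ) (s : ℝ) : MeasurableSpace (DPath d t T) :=
  ⨅ u ∈ Set.Ioi s, ⨆ r ∈ Set.Icc t u,
    MeasurableSpace.comap (fun g : DPath d t T => g.1 r) inferInstance

/-- The family `𝓜̃(t,m)` of probability laws on `𝔻([t,T],𝒫₁)` under which the canonical
process satisfies properties (i) and (ii) of the definition of `𝓜(t,m)`. -/
def MTilde (d : ℕ) (T t : ℝ) (m : Measure (Ed d)) : Set (Measure (DPath d t T)) :=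
  { μ | IsProbabilityMeasure μ ∧
    (∀ φ : Ed d →ᵇ ℝ, ∫ g, (∫ x, φ x ∂(g.1 t)) ∂μ = ∫ x, φ x ∂m) ∧
    (∀ t₁ t₂ : ℝ, t ≤ t₁ → t₁ ≤ t₂ → t₂ ≤ T → ∀ φ : Ed d →ᵇ ℝ,
      μ[(fun g : DPath d t T => ∫ x, φ x ∂(g.1 t₂)) | canonFiltration d t T t₁]
        =ᵐ[μ] fun g => ∫ x, φ x ∂(heatFlow d t₁ t₂ (g.1 t₁))) }

/-- The Hamiltonian `H(t,m) = inf_u sup_v ∫ f(t,x,u,v) dm(x)`. -/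
def hamiltonian {d : ℕ} {A B : Type} (f : ℝ → Ed d → A → B → ℝ)
    (t : ℝ) (m : Measure (Ed d)) : ℝ :=
  ⨅ u : A, ⨆ v : B, ∫ x, f t x u v ∂m

/-- The trajectory of a measure-valued process, as an element of `𝔻([t,T],𝒫₁)`. -/
def MVP.path {d : ℕ} {T t : ℝ} {m : Measure (Ed d)} (X : MVP d T t m) (ω : X.Ω) :
    DPath d t T :=
  ⟨fun s => X.M s ω, fun s hs => X.inP1 s hs ω, X.cadlag ω⟩

/-- The law on `𝔻([t,T],𝒫₁)` of a measure-valued process. -/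
def MVP.law {d : ℕ} {T t : ℝ} {m : Measure (Ed d)} (X : MVP d T t m) :
    Measure (DPath d t T) :=
  @Measure.map X.Ω (DPath d t T) X.mΩ _ X.path X.P

/-! ### The Wasserstein distance `d₁` -/

section Wasserstein

variable {d : ℕ} {μ ν ρ : Measure (Ed d)}

/-- The transport costs of the couplings of `μ` and `ν`. -/
def couplingCosts (d : ℕ) (μ ν : Measure (Ed d)) : Set ℝ :=
  { c : ℝ | ∃ γ : Measure (Ed d × Ed d), IsProbabilityMeasure γ ∧ IsCoupling d γ μ ν ∧
      c = ∫ q, ‖q.1 - q.2‖ ∂γ }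

lemma wdist_one_eq (μ ν : Measure (Ed d)) : wdist d 1 μ ν = sInf (couplingCosts d μ ν) := by
  simp [wdist, couplingCosts]

lemma couplingCosts_bddBelow (μ ν : Measure (Ed d)) : BddBelow (couplingCosts d μ ν) := by
  refine ⟨0, ?_⟩
  rintro c ⟨γ, -, -, rfl⟩
  exact integral_nonneg fun q => norm_nonneg _

lemma couplingCosts_nonempty (hμ : MemP d 1 μ) (hν : MemP d 1 ν) :
    (couplingCosts d μ ν).Nonempty := by
  have := hμ.1
  have := hν.1
  exact ⟨_, μ.prod ν, inferInstance, ⟨by simp, by simp⟩, rfl⟩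

lemma wdist_one_nonneg (μ ν : Measure (Ed d)) : 0 ≤ wdist d 1 μ ν := by
  rw [wdist_one_eq]
  refine Real.sInf_nonneg ?_
  rintro c ⟨γ, -, -, rfl⟩
  exact integral_nonneg fun q => norm_nonneg _

lemma wdist_one_le_integral {γ : Measure (Ed d × Ed d)} [hγ : IsProbabilityMeasure γ]
    (h : IsCoupling d γ μ ν) : wdist d 1 μ ν ≤ ∫ q, ‖q.1 - q.2‖ ∂γ := by
  rw [wdist_one_eq]
  exact csInf_le (couplingCosts_bddBelow μ ν) ⟨γ, hγ, h, rfl⟩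

lemma exists_coupling_lt_add (hμ : MemP d 1 μ) (hν : MemP d 1 ν) {ε : ℝ} (hε : 0 < ε) :
    ∃ γ : Measure (Ed d × Ed d), IsProbabilityMeasure γ ∧ IsCoupling d γ μ ν ∧
      ∫ q, ‖q.1 - q.2‖ ∂γ < wdist d 1 μ ν + ε := by
  obtain ⟨c, ⟨γ, h1, h2, rfl⟩, hc⟩ :=
    Real.lt_sInf_add_pos (couplingCosts_nonempty hμ hν) hε
  exact ⟨γ, h1, h2, by rwa [wdist_one_eq]⟩

lemma wdist_one_comm (μ ν : Measure (Ed d)) : wdist d 1 μ ν = wdist d 1 ν μ := by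
  have key : ∀ μ ν : Measure (Ed d), couplingCosts d μ ν ⊆ couplingCosts d ν μ := by
    rintro μ ν c ⟨γ, h1, ⟨h2, h3⟩, rfl⟩
    refine ⟨γ.map Prod.swap, Measure.isProbabilityMeasure_map measurable_swap.aemeasurable,
      ⟨?_, ?_⟩, ?_⟩
    · rw [Measure.map_map measurable_fst measurable_swap]; exact h3
    · rw [Measure.map_map measurable_snd measurable_swap]; exact h2
    · rw [integral_map measurable_swap.aemeasurable
        (by fun_prop : Continuous fun q : Ed d × Ed d => ‖q.1 - q.2‖).aestronglyMeasurable]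
      simp [norm_sub_rev]
  rw [wdist_one_eq, wdist_one_eq, (key μ ν).antisymm (key ν μ)]

lemma IsCoupling.integrable_norm_sub {γ : Measure (Ed d × Ed d)} (h : IsCoupling d γ μ ν)
    (hμ : MemP d 1 μ) (hν : MemP d 1 ν) : Integrable (fun q => ‖q.1 - q.2‖) γ := by
  have h1 : Integrable (fun q : Ed d × Ed d => ‖q.1‖) γ := by
    have := hμ.2
    simp only [Real.rpow_one] at this
    rw [← h.1] at this
    exact this.comp_measurable measurable_fst
  have h2 : Integrable (fun q : Ed d × Ed d => ‖q.2‖) γ := by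
    have := hν.2
    simp only [Real.rpow_one] at this
    rw [← h.2] at this
    exact this.comp_measurable measurable_snd
  refine (h1.add h2).mono'
    (by fun_prop : Continuous fun q : Ed d × Ed d => ‖q.1 - q.2‖).aestronglyMeasurable ?_
  filter_upwards with q
  simpa using norm_sub_le q.1 q.2

/-- Gluing of two couplings along their common marginal. -/
lemma exists_glued_coupling {γ γ' : Measure (Ed d × Ed d)} [IsProbabilityMeasure γ]
    [IsProbabilityMeasure γ'] (h : IsCoupling d γ μ ν) (h' : IsCoupling d γ' ν ρ) :
    ∃ π : Measure ((Ed d × Ed d) × Ed d), IsProbabilityMeasure π ∧ π.map Prod.fst = γ ∧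
      π.map (fun p => (p.1.2, p.2)) = γ' := by
  have hfst : γ'.fst = γ.map Prod.snd := h'.1.trans h.2.symm
  refine ⟨γ.compProd (γ'.condKernel.comap Prod.snd measurable_snd), inferInstance,
    Measure.fst_compProd _ _, ?_⟩
  have hm : Measurable fun p : (Ed d × Ed d) × Ed d => (p.1.2, p.2) := by fun_prop
  ext s hs
  conv_rhs => rw [← γ'.disintegrate γ'.condKernel, hfst]
  rw [Measure.map_apply hm hs, Measure.compProd_apply (hm hs), Measure.compProd_apply hs,
    lintegral_map (ProbabilityTheory.Kernel.measurable_kernel_prodMk_left hs) measurable_snd]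
  rfl

lemma wdist_one_triangle (hμ : MemP d 1 μ) (hν : MemP d 1 ν) (hρ : MemP d 1 ρ) :
    wdist d 1 μ ρ ≤ wdist d 1 μ ν + wdist d 1 ν ρ := by
  refine le_of_forall_pos_le_add fun ε hε => ?_
  obtain ⟨γ, hγ, hc, hlt⟩ := exists_coupling_lt_add hμ hν (half_pos hε)
  obtain ⟨γ', hγ', hc', hlt'⟩ := exists_coupling_lt_add hν hρ (half_pos hε)
  obtain ⟨π, hπ, h1, h2⟩ := exists_glued_coupling hc hc'
  have hm12 : Measurable (Prod.fst : (Ed d × Ed d) × Ed d → Ed d × Ed d) := measurable_fst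
  have hm23 : Measurable fun p : (Ed d × Ed d) × Ed d => (p.1.2, p.2) := by fun_prop
  have hm13 : Measurable fun p : (Ed d × Ed d) × Ed d => (p.1.1, p.2) := by fun_prop
  have hcont : Continuous fun q : Ed d × Ed d => ‖q.1 - q.2‖ := by fun_prop
  have hcpl : IsCoupling d (π.map fun p => (p.1.1, p.2)) μ ρ := by
    constructor
    · rw [Measure.map_map measurable_fst hm13, ← hc.1, ← h1,
        Measure.map_map measurable_fst measurable_fst]
      rfl
    · rw [Measure.map_map measurable_snd hm13, ← hc'.2, ← h2,
        Measure.map_map measurable_snd hm23]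
      rfl
  have := Measure.isProbabilityMeasure_map (μ := π) hm13.aemeasurable
  have i12 : Integrable (fun p : (Ed d × Ed d) × Ed d => ‖p.1.1 - p.1.2‖) π := by
    have := hc.integrable_norm_sub hμ hν
    rw [← h1] at this
    exact this.comp_measurable hm12
  have i23 : Integrable (fun p : (Ed d × Ed d) × Ed d => ‖p.1.2 - p.2‖) π := by
    have := hc'.integrable_norm_sub hν hρ
    rw [← h2] at this
    exact this.comp_measurable hm23
  have i13 : Integrable (fun p : (Ed d × Ed d) × Ed d => ‖p.1.1 - p.2‖) π :=
    (hcpl.integrable_norm_sub hμ hρ).comp_measurable hm13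
  have e12 : ∫ q, ‖q.1 - q.2‖ ∂γ = ∫ p, ‖p.1.1 - p.1.2‖ ∂π := by
    rw [← h1, integral_map hm12.aemeasurable hcont.aestronglyMeasurable]
  have e23 : ∫ q, ‖q.1 - q.2‖ ∂γ' = ∫ p, ‖p.1.2 - p.2‖ ∂π := by
    rw [← h2, integral_map hm23.aemeasurable hcont.aestronglyMeasurable]
  calc wdist d 1 μ ρ ≤ ∫ q, ‖q.1 - q.2‖ ∂(π.map fun p => (p.1.1, p.2)) :=
        wdist_one_le_integral hcpl
    _ = ∫ p, ‖p.1.1 - p.2‖ ∂π := by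
        rw [integral_map hm13.aemeasurable hcont.aestronglyMeasurable]
    _ ≤ ∫ p, (‖p.1.1 - p.1.2‖ + ‖p.1.2 - p.2‖) ∂π :=
        integral_mono i13 (i12.add i23) fun p => norm_sub_le_norm_sub_add_norm_sub _ _ _
    _ = ∫ q, ‖q.1 - q.2‖ ∂γ + ∫ q, ‖q.1 - q.2‖ ∂γ' := by
        rw [integral_add i12 i23, e12, e23]
    _ ≤ wdist d 1 μ ν + wdist d 1 ν ρ + ε := by linarith

lemma abs_wdist_one_sub_le {μ' ν' : Measure (Ed d)} (hμ : MemP d 1 μ) (hν : MemP d 1 ν)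
    (hμ' : MemP d 1 μ') (hν' : MemP d 1 ν') :
    |wdist d 1 μ ν - wdist d 1 μ' ν'| ≤ wdist d 1 μ μ' + wdist d 1 ν ν' := by
  have h1 := wdist_one_triangle hμ hμ' hν
  have h2 := wdist_one_triangle hμ' hν' hν
  have h3 := wdist_one_triangle hμ' hμ hν'
  have h4 := wdist_one_triangle hμ hν hν'
  rw [wdist_one_comm ν' ν] at h2
  rw [wdist_one_comm μ' μ] at h3
  rw [abs_le]
  constructor <;> linarith

/-- Bounded continuous Lipschitz functions integrate to `d₁`-Lipschitz functions of the measure. -/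
lemma abs_integral_sub_integral_le_wdist {φ : Ed d → ℝ} {C : ℝ} (hC : 0 ≤ C)
    (hφ : Continuous φ) (hb : ∀ x, |φ x| ≤ C) (hl : ∀ x y, |φ x - φ y| ≤ C * ‖x - y‖)
    (hμ : MemP d 1 μ) (hν : MemP d 1 ν) :
    |∫ x, φ x ∂μ - ∫ x, φ x ∂ν| ≤ C * wdist d 1 μ ν := by
  refine le_of_forall_pos_le_add fun ε hε => ?_
  obtain ⟨γ, hγ, hc, hlt⟩ := exists_coupling_lt_add hμ hν (ε := ε / (C + 1)) (by positivity)
  have i : ∀ g : Ed d × Ed d → Ed d, Continuous g → Integrable (fun q => φ (g q)) γ :=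
    fun g hg => Integrable.of_bound (hφ.comp hg).aestronglyMeasurable C
      (Eventually.of_forall fun q => hb _)
  have e1 : ∫ x, φ x ∂μ = ∫ q, φ q.1 ∂γ := by
    rw [← hc.1, integral_map measurable_fst.aemeasurable hφ.aestronglyMeasurable]
  have e2 : ∫ x, φ x ∂ν = ∫ q, φ q.2 ∂γ := by
    rw [← hc.2, integral_map measurable_snd.aemeasurable hφ.aestronglyMeasurable]
  have h3 : C * (ε / (C + 1)) ≤ ε := by
    rw [mul_div_assoc', div_le_iff₀ (by positivity)]
    nlinarith
  calc |∫ x, φ x ∂μ - ∫ x, φ x ∂ν| = |∫ q, (φ q.1 - φ q.2) ∂γ| := by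
        rw [e1, e2, integral_sub (i _ continuous_fst) (i _ continuous_snd)]
    _ ≤ ∫ q, |φ q.1 - φ q.2| ∂γ := abs_integral_le_integral_abs
    _ ≤ ∫ q, C * ‖q.1 - q.2‖ ∂γ :=
        integral_mono ((i _ continuous_fst).sub (i _ continuous_snd)).abs
          ((hc.integrable_norm_sub hμ hν).const_mul C) fun q => hl _ _
    _ = C * ∫ q, ‖q.1 - q.2‖ ∂γ := integral_const_mul _ _
    _ ≤ C * (wdist d 1 μ ν + ε / (C + 1)) := by gcongr
    _ ≤ C * wdist d 1 μ ν + ε := by linarith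

end Wasserstein

/-! ### The Hamiltonian -/

section Hamiltonian

/-- Bounded, continuous running costs which are Lipschitz in the time and space variables. -/
structure IsLipschitzCost {d : ℕ} {A B : Type} [TopologicalSpace A] [TopologicalSpace B]
    (f : ℝ → Ed d → A → B → ℝ) (C : ℝ) : Prop where
  bdd : ∀ t x u v, |f t x u v| ≤ C
  cont : Continuous fun q : ℝ × Ed d × A × B => f q.1 q.2.1 q.2.2.1 q.2.2.2
  lip : ∀ (u : A) (v : B), ∀ s s' : ℝ, ∀ x x' : Ed d,
    |f s x u v - f s' x' u v| ≤ C * (‖x - x'‖ + |s - s'|)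

lemma abs_ciSup_sub_ciSup_le {ι : Type*} [Nonempty ι] {a b : ι → ℝ} {ε : ℝ}
    (ha : BddAbove (range a)) (hb : BddAbove (range b)) (h : ∀ i, |a i - b i| ≤ ε) :
    |(⨆ i, a i) - ⨆ i, b i| ≤ ε := by
  rw [abs_sub_le_iff]
  constructor
  · rw [sub_le_iff_le_add]
    refine ciSup_le fun i => ?_
    linarith [le_ciSup hb i, (abs_le.1 (h i)).2]
  · rw [sub_le_iff_le_add]
    refine ciSup_le fun i => ?_
    linarith [le_ciSup ha i, (abs_le.1 (h i)).1]

lemma abs_ciInf_sub_ciInf_le {ι : Type*} [Nonempty ι] {a b : ι → ℝ} {ε : ℝ}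
    (ha : BddBelow (range a)) (hb : BddBelow (range b)) (h : ∀ i, |a i - b i| ≤ ε) :
    |(⨅ i, a i) - ⨅ i, b i| ≤ ε := by
  rw [abs_sub_le_iff]
  constructor
  · rw [sub_le_comm]
    refine le_ciInf fun i => ?_
    linarith [ciInf_le ha i, (abs_le.1 (h i)).2]
  · rw [sub_le_comm]
    refine le_ciInf fun i => ?_
    linarith [ciInf_le hb i, (abs_le.1 (h i)).1]

variable {d : ℕ} {A B : Type} [MetricSpace A] [CompactSpace A] [Nonempty A]
  [MetricSpace B] [CompactSpace B] [Nonempty B] {f : ℝ → Ed d → A → B → ℝ} {C : ℝ}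

namespace IsLipschitzCost

omit [CompactSpace A] [CompactSpace B] in
lemma nonneg (hf : IsLipschitzCost f C) : 0 ≤ C :=
  (abs_nonneg _).trans (hf.bdd 0 0 (Classical.arbitrary A) (Classical.arbitrary B))

omit [CompactSpace A] [CompactSpace B] [Nonempty A] [Nonempty B] in
lemma continuous_space (hf : IsLipschitzCost f C) (s : ℝ) (u : A) (v : B) :
    Continuous fun x => f s x u v :=
  hf.cont.comp (by fun_prop : Continuous fun x : Ed d => (s, x, u, v))

omit [CompactSpace A] [CompactSpace B] [Nonempty A] [Nonempty B] in
lemma lip_space (hf : IsLipschitzCost f C) (s : ℝ) (u : A) (v : B) (x y : Ed d) :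
    |f s x u v - f s y u v| ≤ C * ‖x - y‖ := by
  simpa using hf.lip u v s s x y

omit [CompactSpace A] [CompactSpace B] [Nonempty A] [Nonempty B] in
lemma integrable (hf : IsLipschitzCost f C) (s : ℝ) (u : A) (v : B) (μ : Measure (Ed d))
    [IsFiniteMeasure μ] : Integrable (fun x => f s x u v) μ :=
  .of_bound (hf.continuous_space s u v).aestronglyMeasurable C
    (Eventually.of_forall fun _ => hf.bdd _ _ _ _)

omit [CompactSpace A] [CompactSpace B] [Nonempty A] [Nonempty B] in
lemma abs_integral_le (hf : IsLipschitzCost f C) (s : ℝ) (u : A) (v : B) (μ : Measure (Ed d))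
    [IsProbabilityMeasure μ] : |∫ x, f s x u v ∂μ| ≤ C := by
  have := norm_integral_le_of_norm_le_const (μ := μ) (f := fun x => f s x u v) (C := C)
    (Eventually.of_forall fun _ => hf.bdd _ _ _ _)
  simpa using this

omit [CompactSpace A] [CompactSpace B] [Nonempty A] [Nonempty B] in
lemma bddAbove_range (hf : IsLipschitzCost f C) (s : ℝ) (u : A) (μ : Measure (Ed d))
    [IsProbabilityMeasure μ] : BddAbove (range fun v => ∫ x, f s x u v ∂μ) :=
  ⟨C, by rintro _ ⟨v, rfl⟩; exact (abs_le.1 (hf.abs_integral_le s u v μ)).2⟩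

omit [CompactSpace A] [CompactSpace B] [Nonempty A] in
lemma abs_iSup_le (hf : IsLipschitzCost f C) (s : ℝ) (u : A) (μ : Measure (Ed d))
    [IsProbabilityMeasure μ] : |⨆ v, ∫ x, f s x u v ∂μ| ≤ C := by
  rw [abs_le]
  exact ⟨(abs_le.1 (hf.abs_integral_le s u (Classical.arbitrary B) μ)).1.trans
    (le_ciSup (hf.bddAbove_range s u μ) _),
    ciSup_le fun v => (abs_le.1 (hf.abs_integral_le s u v μ)).2⟩

omit [CompactSpace A] [CompactSpace B] [Nonempty A] in
lemma bddBelow_range (hf : IsLipschitzCost f C) (s : ℝ) (μ : Measure (Ed d))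
    [IsProbabilityMeasure μ] : BddBelow (range fun u => ⨆ v, ∫ x, f s x u v ∂μ) :=
  ⟨-C, by rintro _ ⟨u, rfl⟩; exact (abs_le.1 (hf.abs_iSup_le s u μ)).1⟩

omit [CompactSpace A] [CompactSpace B] in
lemma abs_hamiltonian_le (hf : IsLipschitzCost f C) (s : ℝ) (μ : Measure (Ed d))
    [IsProbabilityMeasure μ] : |hamiltonian f s μ| ≤ C := by
  rw [hamiltonian, abs_le]
  exact ⟨le_ciInf fun u => (abs_le.1 (hf.abs_iSup_le s u μ)).1,
    (ciInf_le (hf.bddBelow_range s μ) (Classical.arbitrary A)).trans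
      (abs_le.1 (hf.abs_iSup_le s _ μ)).2⟩

omit [CompactSpace A] [CompactSpace B] in
lemma abs_hamiltonian_sub_le (hf : IsLipschitzCost f C) {s s' ε : ℝ} {μ ν : Measure (Ed d)}
    [IsProbabilityMeasure μ] [IsProbabilityMeasure ν]
    (h : ∀ u v, |∫ x, f s x u v ∂μ - ∫ x, f s' x u v ∂ν| ≤ ε) :
    |hamiltonian f s μ - hamiltonian f s' ν| ≤ ε :=
  abs_ciInf_sub_ciInf_le (hf.bddBelow_range s μ) (hf.bddBelow_range s' ν) fun u =>
    abs_ciSup_sub_ciSup_le (hf.bddAbove_range s u μ) (hf.bddAbove_range s' u ν) fun v => h u v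

omit [CompactSpace A] [CompactSpace B] [Nonempty A] [Nonempty B] in
lemma abs_integral_sub_time_le (hf : IsLipschitzCost f C) (s s' : ℝ) (u : A) (v : B)
    (μ : Measure (Ed d)) [IsProbabilityMeasure μ] :
    |∫ x, f s x u v ∂μ - ∫ x, f s' x u v ∂μ| ≤ C * |s - s'| := by
  rw [← integral_sub (hf.integrable s u v μ) (hf.integrable s' u v μ)]
  have := norm_integral_le_of_norm_le_const (μ := μ) (f := fun x => f s x u v - f s' x u v)
    (C := C * |s - s'|) (Eventually.of_forall fun x => by simpa using hf.lip u v s s' x x)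
  simpa using this

omit [CompactSpace A] [CompactSpace B] in
lemma abs_hamiltonian_sub_le_wdist (hf : IsLipschitzCost f C) (s s' : ℝ) {μ ν : Measure (Ed d)}
    (hμ : MemP d 1 μ) (hν : MemP d 1 ν) :
    |hamiltonian f s μ - hamiltonian f s' ν| ≤ C * (wdist d 1 μ ν + |s - s'|) := by
  have := hμ.1
  have := hν.1
  refine hf.abs_hamiltonian_sub_le fun u v => ?_
  have h1 := abs_integral_sub_integral_le_wdist hf.nonneg (hf.continuous_space s u v)
    (fun x => hf.bdd s x u v) (hf.lip_space s u v) hμ hν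
  have h2 := hf.abs_integral_sub_time_le s s' u v ν
  have h3 := abs_sub_le (∫ x, f s x u v ∂μ) (∫ x, f s x u v ∂ν) (∫ x, f s' x u v ∂ν)
  linarith

omit [CompactSpace A] [CompactSpace B] [Nonempty A] [Nonempty B] in
lemma continuous_integral (hf : IsLipschitzCost f C) (s : ℝ) (μ : Measure (Ed d))
    [IsProbabilityMeasure μ] : Continuous fun q : A × B => ∫ x, f s x q.1 q.2 ∂μ :=
  continuous_of_dominated (fun q => (hf.continuous_space s q.1 q.2).aestronglyMeasurable)
    (fun q => Eventually.of_forall fun x => hf.bdd _ _ _ _) (integrable_const C)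
    (Eventually.of_forall fun x =>
      hf.cont.comp (by fun_prop : Continuous fun q : A × B => (s, x, q.1, q.2)))

omit [CompactSpace A] [Nonempty A] [Nonempty B] in
lemma continuous_iSup_integral (hf : IsLipschitzCost f C) (s : ℝ) (μ : Measure (Ed d))
    [IsProbabilityMeasure μ] : Continuous fun u : A => ⨆ v, ∫ x, f s x u v ∂μ := by
  have := isCompact_univ.continuous_sSup (K := (univ : Set B))
    (f := fun (u : A) (v : B) => ∫ x, f s x u v ∂μ) (hf.continuous_integral s μ)
  simpa [image_univ, sSup_range] using this

omit [Nonempty A] [Nonempty B] in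
lemma measurable_hamiltonian (hf : IsLipschitzCost f C) (s : ℝ) {Ω : Type*} [MeasurableSpace Ω]
    {κ : Ω → Measure (Ed d)} (hκ : Measurable κ) (hp : ∀ ω, IsProbabilityMeasure (κ ω)) :
    Measurable fun ω => hamiltonian f s (κ ω) := by
  obtain ⟨SA, hSA, hdA⟩ := TopologicalSpace.exists_countable_dense A
  obtain ⟨SB, hSB, hdB⟩ := TopologicalSpace.exists_countable_dense B
  have := hSA.to_subtype
  have := hSB.to_subtype
  have key : (fun ω => hamiltonian f s (κ ω))
      = fun ω => ⨅ u : SA, ⨆ v : SB, ∫ x, f s x u v ∂(κ ω) := by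
    funext ω
    have := hp ω
    rw [hamiltonian, ← hdA.ciInf' (hf.continuous_iSup_integral s (κ ω))]
    congr 1
    funext u
    exact (hdB.ciSup' ((hf.continuous_integral s (κ ω)).comp
      (by fun_prop : Continuous fun v : B => ((u : A), v)))).symm
  rw [key]
  refine Measurable.iInf fun u => Measurable.iSup fun v => ?_
  exact (StronglyMeasurable.integral_kernel (κ := (⟨κ, hκ⟩ : ProbabilityTheory.Kernel Ω (Ed d)))
    (hf.continuous_space s u v).stronglyMeasurable).measurable

end IsLipschitzCost

end Hamiltonian

/-! ### Right-continuous processes -/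

section RightContinuous

/-- A right-continuous process with measurable time marginals is jointly measurable. -/
lemma measurable_uncurry_of_rightContinuous {Ω : Type*} [MeasurableSpace Ω] {Z : ℝ → Ω → ℝ}
    (hm : ∀ s, Measurable (Z s)) (hr : ∀ ω s, ContinuousWithinAt (fun r => Z r ω) (Ici s) s) :
    Measurable fun p : ℝ × Ω => Z p.1 p.2 := by
  have hn : ∀ n : ℕ, (0 : ℝ) < n + 1 := fun n => by positivity
  refine measurable_of_tendsto_metrizable
    (f := fun (n : ℕ) (p : ℝ × Ω) => Z ((⌊p.1 * (n + 1)⌋ + 1) / (n + 1)) p.2) (fun n => ?_) ?_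
  · have h1 : Measurable fun q : ℤ × Ω => Z ((q.1 + 1) / (n + 1)) q.2 :=
      measurable_from_prod_countable_right fun k => hm (((k : ℝ) + 1) / (n + 1))
    have h2 : Measurable fun p : ℝ × Ω => (⌊p.1 * (n + 1)⌋, p.2) := by fun_prop
    exact h1.comp h2
  · rw [tendsto_pi_nhds]
    rintro ⟨s, ω⟩
    have hge : ∀ n : ℕ, s ≤ ((⌊s * (n + 1)⌋ : ℝ) + 1) / (n + 1) := fun n => by
      rw [le_div_iff₀ (hn n)]
      exact (Int.lt_floor_add_one _).le
    have hle : ∀ n : ℕ, ((⌊s * (n + 1)⌋ : ℝ) + 1) / (n + 1) ≤ s + 1 / (n + 1) := fun n => by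
      rw [div_le_iff₀ (hn n), add_mul, one_div, inv_mul_cancel₀ (hn n).ne']
      linarith [Int.floor_le (s * ((n : ℝ) + 1))]
    have hlim : Tendsto (fun n : ℕ => ((⌊s * (n + 1)⌋ : ℝ) + 1) / (n + 1)) atTop (𝓝 s) := by
      refine tendsto_of_tendsto_of_tendsto_of_le_of_le tendsto_const_nhds ?_ hge hle
      simpa using tendsto_one_div_add_atTop_nhds_zero_nat.const_add s
    exact (hr ω s).tendsto.comp
      (tendsto_nhdsWithin_iff.2 ⟨hlim, Eventually.of_forall hge⟩)

/-- The projection of the real line onto `[t, T]`. -/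
def clamp (t T s : ℝ) : ℝ := max t (min T s)

variable {t T : ℝ}

lemma clamp_mem (htT : t ≤ T) (s : ℝ) : clamp t T s ∈ Icc t T :=
  ⟨le_max_left _ _, max_le htT (min_le_left _ _)⟩

lemma clamp_eq {s : ℝ} (hs : s ∈ Icc t T) : clamp t T s = s := by
  rw [clamp, min_eq_right hs.2, max_eq_right hs.1]

lemma clamp_mono : Monotone (clamp t T) :=
  fun _ _ h => max_le_max le_rfl (min_le_min le_rfl h)

lemma continuous_clamp : Continuous (clamp t T) := by
  unfold clamp
  fun_prop

lemma continuousWithinAt_comp_clamp (htT : t ≤ T) {φ : ℝ → ℝ}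
    (h : ∀ s ∈ Ico t T, ContinuousWithinAt φ (Ici s) s) (s : ℝ) :
    ContinuousWithinAt (fun r => φ (clamp t T r)) (Ici s) s := by
  rcases (clamp_mem htT s).2.lt_or_eq with hlt | heq
  · exact (h _ ⟨(clamp_mem htT s).1, hlt⟩).comp continuous_clamp.continuousWithinAt
      fun r hr => clamp_mono hr
  · refine (continuousWithinAt_const (b := φ T)).congr (fun r hr => ?_) (by rw [heq])
    have h2 : clamp t T s ≤ clamp t T r := clamp_mono hr
    rw [(clamp_mem htT r).2.antisymm (heq.symm.le.trans h2)]

/-- A process which is right-continuous on `[t, T)` is, up to freezing it outside `[t, T]`,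
jointly measurable. -/
lemma measurable_uncurry_comp_clamp {Ω : Type*} [MeasurableSpace Ω] (htT : t ≤ T)
    {Z : ℝ → Ω → ℝ} (hm : ∀ s ∈ Icc t T, Measurable (Z s))
    (hr : ∀ ω, ∀ s ∈ Ico t T, ContinuousWithinAt (fun r => Z r ω) (Ici s) s) :
    Measurable fun p : ℝ × Ω => Z (clamp t T p.1) p.2 :=
  measurable_uncurry_of_rightContinuous (Z := fun s => Z (clamp t T s))
    (fun s => hm _ (clamp_mem htT s))
    fun ω s => continuousWithinAt_comp_clamp htT (φ := fun r => Z r ω) (hr ω) s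

variable {d : ℕ} {g h : ℝ → Measure (Ed d)}

lemma IsD1Path.continuousWithinAt_of_abs_sub_le (hg : IsD1Path d t T g) {φ : ℝ → ℝ} {C : ℝ}
    (hφ : ∀ r ∈ Icc t T, ∀ s ∈ Icc t T, |φ r - φ s| ≤ C * (wdist d 1 (g r) (g s) + |r - s|))
    {s : ℝ} (hs : s ∈ Ico t T) : ContinuousWithinAt φ (Ici s) s := by
  rw [ContinuousWithinAt, tendsto_iff_dist_tendsto_zero]
  have h1 : Tendsto (fun r => C * (wdist d 1 (g r) (g s) + |r - s|)) (𝓝[Ici s] s) (𝓝 0) := by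
    have h2 : Tendsto (fun r : ℝ => |r - s|) (𝓝[Ici s] s) (𝓝 0) := by
      have : Continuous fun r : ℝ => |r - s| := by fun_prop
      simpa using (this.tendsto s).mono_left nhdsWithin_le_nhds
    simpa using ((hg.2.1 s hs).add h2).const_mul C
  refine squeeze_zero' (Eventually.of_forall fun r => dist_nonneg) ?_ h1
  have h3 : ∀ᶠ r in 𝓝[Ici s] s, r < T := nhdsWithin_le_nhds (gt_mem_nhds hs.2)
  filter_upwards [h3, self_mem_nhdsWithin] with r hr hr'
  exact hφ r ⟨hs.1.trans hr', hr.le⟩ s ⟨hs.1, hs.2.le⟩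

lemma IsD1Path.continuousWithinAt_wdist (hg : IsD1Path d t T g) (hh : IsD1Path d t T h)
    {s : ℝ} (hs : s ∈ Ico t T) :
    ContinuousWithinAt (fun r => wdist d 1 (g r) (h r)) (Ici s) s := by
  rw [ContinuousWithinAt, tendsto_iff_dist_tendsto_zero]
  have h1 : Tendsto (fun r => wdist d 1 (g r) (g s) + wdist d 1 (h r) (h s))
      (𝓝[Ici s] s) (𝓝 0) := by
    simpa using (hg.2.1 s hs).add (hh.2.1 s hs)
  refine squeeze_zero' (Eventually.of_forall fun r => dist_nonneg) ?_ h1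
  have h3 : ∀ᶠ r in 𝓝[Ici s] s, r < T := nhdsWithin_le_nhds (gt_mem_nhds hs.2)
  filter_upwards [h3, self_mem_nhdsWithin] with r hr hr'
  have hr2 : r ∈ Icc t T := ⟨hs.1.trans hr', hr.le⟩
  have hs2 : s ∈ Icc t T := ⟨hs.1, hs.2.le⟩
  exact abs_wdist_one_sub_le (hg.1 r hr2) (hh.1 r hr2) (hg.1 s hs2) (hh.1 s hs2)

/-- A function on `[t, T]` which is right-continuous on `[t, T)` is a.e. measurable there. -/
lemma aestronglyMeasurable_restrict_of_rightContinuous (htT : t ≤ T) {φ : ℝ → ℝ}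
    (h : ∀ s ∈ Ico t T, ContinuousWithinAt φ (Ici s) s) :
    AEStronglyMeasurable φ (volume.restrict (Icc t T)) := by
  have h1 : Measurable fun s => φ (clamp t T s) :=
    (measurable_uncurry_comp_clamp (Ω := Unit) htT (Z := fun s _ => φ s)
      (fun _ _ => measurable_const) fun _ => h).comp (by fun_prop : Measurable fun s : ℝ => (s, ()))
  refine h1.aestronglyMeasurable.congr ?_
  filter_upwards [ae_restrict_mem measurableSet_Icc] with s hs
  rw [clamp_eq hs]

end RightContinuous

/-! ### Continuity of the integrated Hamiltonian for `κ₁` -/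

section PathFunctional

variable {d : ℕ} {t T : ℝ} {A B : Type} [MetricSpace A] [CompactSpace A] [Nonempty A]
  [MetricSpace B] [CompactSpace B] [Nonempty B] {f : ℝ → Ed d → A → B → ℝ} {C : ℝ}

lemma measurable_DPath_eval {s : ℝ} (hs : s ∈ Icc t T) :
    Measurable fun g : DPath d t T => g.1 s := by
  rw [measurable_iff_comap_le]
  exact le_iSup₂_of_le s hs le_rfl

lemma measurable_DPath_iff {Ω : Type*} [MeasurableSpace Ω] {Φ : Ω → DPath d t T} :
    Measurable Φ ↔ ∀ s ∈ Icc t T, Measurable fun ω => (Φ ω).1 s := by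
  refine ⟨fun h s hs => (measurable_DPath_eval hs).comp h, fun h => ?_⟩
  rw [measurable_iff_comap_le, instMeasDPath]
  simp only [MeasurableSpace.comap_iSup, MeasurableSpace.comap_comp, iSup_le_iff]
  exact fun s hs => measurable_iff_comap_le.1 (h s hs)

namespace IsLipschitzCost

omit [CompactSpace A] [CompactSpace B] in
lemma continuousWithinAt_hamiltonian (hf : IsLipschitzCost f C) {g : ℝ → Measure (Ed d)}
    (hg : IsD1Path d t T g) {s : ℝ} (hs : s ∈ Ico t T) :
    ContinuousWithinAt (fun r => hamiltonian f r (g r)) (Ici s) s :=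
  hg.continuousWithinAt_of_abs_sub_le (C := C)
    (fun r hr s hs => hf.abs_hamiltonian_sub_le_wdist r s (hg.1 r hr) (hg.1 s hs)) hs

lemma measurable_uncurry_hamiltonian (hf : IsLipschitzCost f C) (htT : t ≤ T) {Ω : Type*}
    [MeasurableSpace Ω] {Φ : Ω → DPath d t T} (hΦ : Measurable Φ) :
    Measurable fun p : ℝ × Ω =>
      hamiltonian f (clamp t T p.1) ((Φ p.2).1 (clamp t T p.1)) :=
  measurable_uncurry_comp_clamp htT (Z := fun s ω => hamiltonian f s ((Φ ω).1 s))
    (fun s hs => hf.measurable_hamiltonian s (measurable_DPath_iff.1 hΦ s hs)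
      fun ω => ((Φ ω).2.1 s hs).1)
    fun ω _ hs => hf.continuousWithinAt_hamiltonian (Φ ω).2 hs

omit [CompactSpace A] [CompactSpace B] in
lemma integrableOn_hamiltonian (hf : IsLipschitzCost f C) (htT : t ≤ T) (g : DPath d t T) :
    IntegrableOn (fun s => hamiltonian f s (g.1 s)) (Icc t T) := by
  refine Integrable.of_bound (aestronglyMeasurable_restrict_of_rightContinuous htT
    fun s hs => hf.continuousWithinAt_hamiltonian g.2 hs) C ?_
  filter_upwards [ae_restrict_mem measurableSet_Icc] with s hs
  have := (g.2.1 s hs).1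
  exact hf.abs_hamiltonian_le s (g.1 s)

lemma measurable_integral_hamiltonian (hf : IsLipschitzCost f C) (htT : t ≤ T) :
    Measurable fun g : DPath d t T => ∫ s in Icc t T, hamiltonian f s (g.1 s) := by
  have h1 : (fun g : DPath d t T => ∫ s in Icc t T, hamiltonian f s (g.1 s)) = fun g =>
      ∫ s in Icc t T, hamiltonian f (clamp t T s) (g.1 (clamp t T s)) := by
    funext g
    refine setIntegral_congr_fun measurableSet_Icc fun s hs => ?_
    simp only [clamp_eq hs]
  rw [h1]
  exact (StronglyMeasurable.integral_prod_left
    (f := fun s (g : DPath d t T) => hamiltonian f (clamp t T s) (g.1 (clamp t T s)))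
    (hf.measurable_uncurry_hamiltonian htT measurable_id).stronglyMeasurable).measurable

omit [CompactSpace A] [CompactSpace B] in
lemma abs_integral_hamiltonian_le (hf : IsLipschitzCost f C) (htT : t ≤ T) (g : DPath d t T) :
    |∫ s in Icc t T, hamiltonian f s (g.1 s)| ≤ C * (T - t) := by
  have := norm_setIntegral_le_of_norm_le_const (μ := volume) (s := Icc t T)
    (f := fun s => hamiltonian f s (g.1 s)) (C := C) (by simp)
    (fun s hs => by
      have := (g.2.1 s hs).1
      exact hf.abs_hamiltonian_le s (g.1 s))
  simpa [Measure.real, Real.volume_Icc, htT] using this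

omit [CompactSpace A] [CompactSpace B] in
lemma abs_integral_hamiltonian_sub_le_distD (hf : IsLipschitzCost f C) (htT : t ≤ T)
    (g g' : DPath d t T) :
    |(∫ s in Icc t T, hamiltonian f s (g'.1 s)) - ∫ s in Icc t T, hamiltonian f s (g.1 s)|
      ≤ 2 * C * distD d t T g g' := by
  have hC := hf.nonneg
  have hw : IntegrableOn (fun s => min 1 (wdist d 1 (g.1 s) (g'.1 s))) (Icc t T) := by
    refine Integrable.of_bound (C := 1) ?_ ?_
    · exact aestronglyMeasurable_restrict_of_rightContinuous htT fun s hs =>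
        continuousWithinAt_const.min (g.2.continuousWithinAt_wdist g'.2 hs)
    · refine Eventually.of_forall fun s => ?_
      rw [Real.norm_of_nonneg (le_min zero_le_one (wdist_one_nonneg _ _))]
      exact min_le_left _ _
  have hle : ∀ s ∈ Icc t T, |hamiltonian f s (g'.1 s) - hamiltonian f s (g.1 s)|
      ≤ 2 * C * min 1 (wdist d 1 (g.1 s) (g'.1 s)) := by
    intro s hs
    have hg := g.2.1 s hs
    have hg' := g'.2.1 s hs
    have := hg.1
    have := hg'.1
    have h1 := hf.abs_hamiltonian_sub_le_wdist s s hg' hg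
    rw [wdist_one_comm, sub_self, abs_zero, add_zero] at h1
    have h2 := hf.abs_hamiltonian_le s (g.1 s)
    have h3 := hf.abs_hamiltonian_le s (g'.1 s)
    have h4 := abs_sub (hamiltonian f s (g'.1 s)) (hamiltonian f s (g.1 s))
    have h5 := wdist_one_nonneg (g.1 s) (g'.1 s)
    rcases min_cases 1 (wdist d 1 (g.1 s) (g'.1 s)) with ⟨h, -⟩ | ⟨h, -⟩ <;> rw [h]
    · linarith
    · nlinarith
  rw [← integral_sub (hf.integrableOn_hamiltonian htT g') (hf.integrableOn_hamiltonian htT g)]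
  calc |∫ s in Icc t T, (hamiltonian f s (g'.1 s) - hamiltonian f s (g.1 s))|
      ≤ ∫ s in Icc t T, |hamiltonian f s (g'.1 s) - hamiltonian f s (g.1 s)| :=
        abs_integral_le_integral_abs
    _ ≤ ∫ s in Icc t T, 2 * C * min 1 (wdist d 1 (g.1 s) (g'.1 s)) :=
        setIntegral_mono_on ((hf.integrableOn_hamiltonian htT g').sub
          (hf.integrableOn_hamiltonian htT g)).abs (hw.const_mul _) measurableSet_Icc hle
    _ = 2 * C * ∫ s in Icc t T, min 1 (wdist d 1 (g.1 s) (g'.1 s)) := integral_const_mul _ _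
    _ ≤ 2 * C * distD d t T g g' := by
        rw [distD]
        gcongr
        simpa using wdist_one_nonneg (g.1 T) (g'.1 T)

end IsLipschitzCost

attribute [local instance] MVP.mΩ MVP.probP

lemma MVP.measurable_path {m : Measure (Ed d)} (X : MVP d T t m) : Measurable X.path :=
  measurable_DPath_iff.2 fun s _ => X.meas s

/-- The expected integrated Hamiltonian is continuous for the convergence in law `𝓛(κ₁)`. -/
lemma IsLipschitzCost.tendsto_integral_integral_hamiltonian (hf : IsLipschitzCost f C)
    (htT : t ≤ T) {m : Measure (Ed d)} {Xseq : ℕ → MVP d T t m} {Y : MVP d T t m}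
    (hconv : ∀ F : DPath d t T → ℝ, (∃ c : ℝ, ∀ g, |F g| ≤ c) →
      (∀ g : DPath d t T, ∀ ε > (0:ℝ), ∃ η > (0:ℝ), ∀ g' : DPath d t T,
        distD d t T g g' < η → |F g' - F g| < ε) →
      Tendsto (fun n => ∫ g, F g ∂(Xseq n).law) atTop (𝓝 (∫ g, F g ∂Y.law))) :
    Tendsto (fun n => ∫ ω, (∫ s in Icc t T, hamiltonian f s ((Xseq n).M s ω)) ∂(Xseq n).P)
      atTop (𝓝 (∫ ω, (∫ s in Icc t T, hamiltonian f s (Y.M s ω)) ∂Y.P)) := by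
  have hC := hf.nonneg
  have key : ∀ X : MVP d T t m, ∫ g, (∫ s in Icc t T, hamiltonian f s (g.1 s)) ∂X.law
      = ∫ ω, (∫ s in Icc t T, hamiltonian f s (X.M s ω)) ∂X.P := fun X =>
    integral_map X.measurable_path.aemeasurable
      (hf.measurable_integral_hamiltonian htT).aestronglyMeasurable
  simp only [← key]
  refine hconv _ ⟨C * (T - t), hf.abs_integral_hamiltonian_le htT⟩ fun g ε hε =>
    ⟨ε / (2 * C + 1), by positivity, fun g' hg' => ?_⟩
  refine (hf.abs_integral_hamiltonian_sub_le_distD htT g g').trans_lt ?_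
  rw [lt_div_iff₀ (by positivity)] at hg'
  have h0 : 0 ≤ distD d t T g g' :=
    add_nonneg (integral_nonneg fun s => le_min zero_le_one (wdist_one_nonneg _ _))
      (le_min zero_le_one (wdist_one_nonneg _ _))
  rcases h0.eq_or_lt with h | h
  · rw [← h]; simpa using hε
  · linarith

end PathFunctional

/-! ### Gaussian estimates -/

section Gaussian

variable {d : ℕ}

lemma abs_integral_le_of_abs_le {α : Type*} [MeasurableSpace α] {μ : Measure α}
    [IsProbabilityMeasure μ] {φ : α → ℝ} {C : ℝ} (h : ∀ x, |φ x| ≤ C) : |∫ x, φ x ∂μ| ≤ C := by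
  simpa using norm_integral_le_of_norm_le_const (μ := μ) (f := φ) (Eventually.of_forall h)

lemma integral_exp_neg_sq_div (d : ℕ) {δ : ℝ} (hδ : 0 < δ) :
    ∫ x : Ed d, Real.exp (-‖x‖ ^ 2 / (2 * δ)) = (2 * Real.pi * δ) ^ ((d : ℝ) / 2) := by
  have h := GaussianFourier.integral_rexp_neg_mul_sq_norm (V := Ed d)
    (b := 1 / (2 * δ)) (by positivity)
  rw [finrank_euclideanSpace_fin] at h
  convert h using 2
  · funext x; ring_nf
  · field_simp

lemma integrable_exp_neg_sq_div (d : ℕ) {δ : ℝ} (hδ : 0 < δ) :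
    Integrable fun x : Ed d => Real.exp (-‖x‖ ^ 2 / (2 * δ)) := by
  by_contra h
  have h1 := integral_exp_neg_sq_div d hδ
  rw [integral_undef h] at h1
  have : (0 : ℝ) < (2 * Real.pi * δ) ^ ((d : ℝ) / 2) := by positivity
  exact this.ne h1

lemma gaussDensity_nonneg (d : ℕ) {δ : ℝ} (hδ : 0 < δ) (x : Ed d) : 0 ≤ gaussDensity d δ x := by
  unfold gaussDensity
  positivity

lemma continuous_gaussDensity (d : ℕ) (δ : ℝ) : Continuous (gaussDensity d δ) := by
  unfold gaussDensity
  fun_prop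

lemma isProbabilityMeasure_gaussMeasure (d : ℕ) {δ : ℝ} (hδ : 0 < δ) :
    IsProbabilityMeasure (gaussMeasure d δ) := by
  constructor
  have hi : Integrable (gaussDensity d δ) := (integrable_exp_neg_sq_div d hδ).const_mul _
  rw [gaussMeasure, withDensity_apply _ MeasurableSet.univ, Measure.restrict_univ,
    ← ofReal_integral_eq_lintegral_ofReal hi (Eventually.of_forall (gaussDensity_nonneg d hδ))]
  simp only [gaussDensity]
  rw [integral_const_mul, integral_exp_neg_sq_div d hδ, ← Real.rpow_add (by positivity)]
  simp [neg_div]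

lemma integrable_gaussMeasure_iff {δ : ℝ} (hδ : 0 < δ) {F : Ed d → ℝ} :
    Integrable F (gaussMeasure d δ) ↔ Integrable fun x => gaussDensity d δ x * F x := by
  rw [gaussMeasure, integrable_withDensity_iff_integrable_smul'
    (continuous_gaussDensity d δ).measurable.ennreal_ofReal (by simp)]
  simp [ENNReal.toReal_ofReal (gaussDensity_nonneg d hδ _)]

lemma integral_gaussMeasure {δ : ℝ} (hδ : 0 < δ) (F : Ed d → ℝ) :
    ∫ x, F x ∂(gaussMeasure d δ) = ∫ x, gaussDensity d δ x * F x := by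
  rw [gaussMeasure, integral_withDensity_eq_integral_toReal_smul
    (continuous_gaussDensity d δ).measurable.ennreal_ofReal (by simp)]
  simp [ENNReal.toReal_ofReal (gaussDensity_nonneg d hδ _)]

/-- A constant bounding the second moment of the standard Gaussian measure on `ℝ^d`. -/
def gaussConst (d : ℕ) : ℝ := 4 * 2 ^ ((d : ℝ) / 2)

lemma gaussConst_nonneg (d : ℕ) : 0 ≤ gaussConst d := by
  unfold gaussConst
  positivity

lemma gaussDensity_mul_sq_le {δ : ℝ} (hδ : 0 < δ) (x : Ed d) :
    gaussDensity d δ x * ‖x‖ ^ 2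
      ≤ (2 * Real.pi * δ) ^ (-(d : ℝ) / 2) * (4 * δ) * Real.exp (-‖x‖ ^ 2 / (2 * (2 * δ))) := by
  have h1 : ‖x‖ ^ 2 / (4 * δ) ≤ Real.exp (‖x‖ ^ 2 / (4 * δ)) := by
    linarith [Real.add_one_le_exp (‖x‖ ^ 2 / (4 * δ))]
  have h2 : ‖x‖ ^ 2 ≤ 4 * δ * Real.exp (‖x‖ ^ 2 / (4 * δ)) := by
    rwa [div_le_iff₀' (by positivity)] at h1
  have h3 : Real.exp (-‖x‖ ^ 2 / (2 * δ)) * Real.exp (‖x‖ ^ 2 / (4 * δ))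
      = Real.exp (-‖x‖ ^ 2 / (2 * (2 * δ))) := by
    rw [← Real.exp_add]
    congr 1
    field_simp
    ring
  calc gaussDensity d δ x * ‖x‖ ^ 2
      ≤ gaussDensity d δ x * (4 * δ * Real.exp (‖x‖ ^ 2 / (4 * δ))) := by
        gcongr
        exact gaussDensity_nonneg d hδ x
    _ = _ := by
        rw [← h3, gaussDensity]
        ring

lemma integrable_sq_gaussMeasure {δ : ℝ} (hδ : 0 < δ) :
    Integrable (fun x => ‖x‖ ^ 2) (gaussMeasure d δ) := by
  rw [integrable_gaussMeasure_iff hδ]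
  refine ((integrable_exp_neg_sq_div d (by positivity : 0 < 2 * δ)).const_mul
      ((2 * Real.pi * δ) ^ (-(d : ℝ) / 2) * (4 * δ))).mono'
    ((continuous_gaussDensity d δ).mul (by fun_prop)).aestronglyMeasurable
    (Eventually.of_forall fun x => ?_)
  rw [Real.norm_of_nonneg (mul_nonneg (gaussDensity_nonneg d hδ x) (by positivity))]
  exact gaussDensity_mul_sq_le hδ x

lemma integral_sq_gaussMeasure_le {δ : ℝ} (hδ : 0 < δ) :
    ∫ x, ‖x‖ ^ 2 ∂(gaussMeasure d δ) ≤ gaussConst d * δ := by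
  have hi := (integrable_gaussMeasure_iff hδ).1 (integrable_sq_gaussMeasure (d := d) hδ)
  rw [integral_gaussMeasure hδ]
  refine (integral_mono hi ((integrable_exp_neg_sq_div d
    (by positivity : 0 < 2 * δ)).const_mul _) (gaussDensity_mul_sq_le hδ)).trans_eq ?_
  rw [integral_const_mul, integral_exp_neg_sq_div d (by positivity),
    show 2 * Real.pi * (2 * δ) = 2 * (2 * Real.pi * δ) by ring,
    Real.mul_rpow (by positivity : (0 : ℝ) ≤ 2) (by positivity), gaussConst, neg_div,
    Real.rpow_neg (by positivity)]
  have : (0 : ℝ) < (2 * Real.pi * δ) ^ ((d : ℝ) / 2) := by positivity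
  field_simp

lemma norm_le_sq_div_add {δ : ℝ} (hδ : 0 < δ) (x : ℝ) : |x| ≤ x ^ 2 / δ + δ := by
  rw [← sub_nonneg]
  have h : x ^ 2 / δ + δ - |x| = ((|x| - δ / 2) ^ 2 + 3 / 4 * δ ^ 2) / δ := by
    rw [← sq_abs x]
    field_simp
    ring
  rw [h]
  positivity

lemma integrable_norm_gaussMeasure {δ : ℝ} (hδ : 0 < δ) :
    Integrable (fun x => ‖x‖) (gaussMeasure d δ) := by
  have := isProbabilityMeasure_gaussMeasure d hδ
  refine ((integrable_sq_gaussMeasure hδ).add (integrable_const (1 : ℝ))).mono'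
    continuous_norm.aestronglyMeasurable (Eventually.of_forall fun x => ?_)
  simpa using norm_le_sq_div_add one_pos ‖x‖

lemma integral_norm_gaussMeasure_le {δ : ℝ} (hδ : 0 < δ) :
    ∫ x, ‖x‖ ∂(gaussMeasure d δ) ≤ (gaussConst d + 1) * √δ := by
  have := isProbabilityMeasure_gaussMeasure d hδ
  obtain ⟨c, hs, hc⟩ : ∃ c : ℝ, 0 < c ∧ c = √δ := ⟨_, Real.sqrt_pos.2 hδ, rfl⟩
  have i2 : Integrable (fun x => ‖x‖ ^ 2 / c) (gaussMeasure d δ) :=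
    (integrable_sq_gaussMeasure hδ).div_const _
  have h1 : ∫ x, ‖x‖ ∂(gaussMeasure d δ) ≤ ∫ x, (‖x‖ ^ 2 / c + c) ∂(gaussMeasure d δ) := by
    refine integral_mono (integrable_norm_gaussMeasure hδ) (i2.add (integrable_const _)) fun x => ?_
    simpa only [abs_norm] using norm_le_sq_div_add hs ‖x‖
  have h2 : ∫ x, (‖x‖ ^ 2 / c + c) ∂(gaussMeasure d δ)
      = (∫ x, ‖x‖ ^ 2 ∂(gaussMeasure d δ)) / c + c := by
    rw [integral_add i2 (integrable_const _), integral_div]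
    simp
  have h3 : (∫ x, ‖x‖ ^ 2 ∂(gaussMeasure d δ)) / c ≤ gaussConst d * c := by
    rw [div_le_iff₀ hs, mul_assoc, hc, Real.mul_self_sqrt hδ.le]
    exact integral_sq_gaussMeasure_le hδ
  rw [← hc]
  linarith

lemma integral_heatFlow {r s : ℝ} (hrs : r < s) (μ : Measure (Ed d)) [IsProbabilityMeasure μ]
    {φ : Ed d → ℝ} (hφ : Continuous φ) {C : ℝ} (hb : ∀ x, |φ x| ≤ C) :
    ∫ x, φ x ∂(heatFlow d r s μ) = ∫ x, ∫ y, φ (x + y) ∂(gaussMeasure d (s - r)) ∂μ := by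
  have := isProbabilityMeasure_gaussMeasure d (sub_pos.2 hrs)
  have hc : Continuous fun q : Ed d × Ed d => q.1 + q.2 := by fun_prop
  rw [heatFlow, if_neg hrs.not_ge, integral_map hc.measurable.aemeasurable
    hφ.aestronglyMeasurable, integral_prod]
  exact .of_bound (hφ.comp hc).aestronglyMeasurable C (Eventually.of_forall fun _ => hb _)

lemma abs_integral_heatFlow_sub_le {r s : ℝ} (hrs : r ≤ s) (μ : Measure (Ed d))
    [IsProbabilityMeasure μ] {φ : Ed d → ℝ} (hφ : Continuous φ) {C : ℝ} (hC : 0 ≤ C)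
    (hb : ∀ x, |φ x| ≤ C) (hl : ∀ x y, |φ x - φ y| ≤ C * ‖x - y‖) :
    |∫ x, φ x ∂(heatFlow d r s μ) - ∫ x, φ x ∂μ| ≤ C * (gaussConst d + 1) * √(s - r) := by
  rcases hrs.eq_or_lt with rfl | hlt
  · simp [heatFlow]
  have hδ := sub_pos.2 hlt
  have := isProbabilityMeasure_gaussMeasure d hδ
  set G := gaussMeasure d (s - r)
  have i1 : ∀ x, Integrable (fun y => φ (x + y)) G := fun x =>
    .of_bound (hφ.comp (by fun_prop : Continuous fun y => x + y)).aestronglyMeasurable C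
      (Eventually.of_forall fun _ => hb _)
  have hx : ∀ x, |(∫ y, φ (x + y) ∂G) - φ x| ≤ C * (gaussConst d + 1) * √(s - r) := by
    intro x
    calc |(∫ y, φ (x + y) ∂G) - φ x| = |∫ y, (φ (x + y) - φ x) ∂G| := by
          rw [integral_sub (i1 x) (integrable_const _)]
          simp
      _ ≤ ∫ y, |φ (x + y) - φ x| ∂G := abs_integral_le_integral_abs
      _ ≤ ∫ y, C * ‖y‖ ∂G :=
          integral_mono ((i1 x).sub (integrable_const _)).abs
            ((integrable_norm_gaussMeasure hδ).const_mul C) fun y => by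
              simpa using hl (x + y) x
      _ = C * ∫ y, ‖y‖ ∂G := integral_const_mul _ _
      _ ≤ C * ((gaussConst d + 1) * √(s - r)) := by
          gcongr
          exact integral_norm_gaussMeasure_le hδ
      _ = _ := by ring
  have i2 : Integrable (fun x => ∫ y, φ (x + y) ∂G) μ := by
    refine Integrable.of_bound (C := C) ?_ (Eventually.of_forall fun x => ?_)
    · exact (hφ.comp (by fun_prop : Continuous fun q : Ed d × Ed d => q.1 + q.2)
        ).stronglyMeasurable.integral_prod_right'.aestronglyMeasurable
    · exact abs_integral_le_of_abs_le fun y => hb (x + y)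
  rw [integral_heatFlow hlt μ hφ hb, ← integral_sub i2
    (.of_bound hφ.aestronglyMeasurable C (Eventually.of_forall hb))]
  exact abs_integral_le_of_abs_le hx

lemma integral_heatFlow_tail_le {r s R : ℝ} (hrs : r ≤ s) (hR : 0 < R) (μ : Measure (Ed d))
    [IsProbabilityMeasure μ] :
    ∫ x, min 1 (‖x‖ ^ 2 / R) ∂(heatFlow d r s μ)
      ≤ ∫ x, min 1 (2 * ‖x‖ ^ 2 / R) ∂μ + 2 * gaussConst d * (s - r) / R := by
  have hb : ∀ c : ℝ, 0 ≤ c → ∀ x : Ed d, |min 1 (c * ‖x‖ ^ 2 / R)| ≤ 1 := fun c hc x => by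
    rw [abs_of_nonneg (le_min zero_le_one (by positivity))]
    exact min_le_left _ _
  have hb1 : ∀ x : Ed d, |min 1 (‖x‖ ^ 2 / R)| ≤ 1 := by simpa using hb 1 zero_le_one
  have hcont : ∀ c : ℝ, Continuous fun x : Ed d => min 1 (c * ‖x‖ ^ 2 / R) := by
    intro c
    fun_prop
  have hcont1 : Continuous fun x : Ed d => min 1 (‖x‖ ^ 2 / R) := by fun_prop
  have hinteg : ∀ (c : ℝ), 0 ≤ c → Integrable (fun x : Ed d => min 1 (c * ‖x‖ ^ 2 / R)) μ :=
    fun c hc => .of_bound (hcont c).aestronglyMeasurable 1 (Eventually.of_forall (hb c hc))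
  rcases hrs.eq_or_lt with rfl | hlt
  · simp only [heatFlow, le_refl, if_true, sub_self, mul_zero, zero_div, add_zero]
    refine integral_mono (by simpa using hinteg 1 zero_le_one) (hinteg 2 zero_le_two) fun x => ?_
    have : (0 : ℝ) ≤ ‖x‖ ^ 2 := by positivity
    exact min_le_min le_rfl (by gcongr; linarith)
  have hδ := sub_pos.2 hlt
  have := isProbabilityMeasure_gaussMeasure d hδ
  rw [integral_heatFlow hlt μ hcont1 hb1]
  set G := gaussMeasure d (s - r)
  have i1 : ∀ x : Ed d, Integrable (fun y => min 1 (‖x + y‖ ^ 2 / R)) G := fun x =>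
    .of_bound (hcont1.comp (by fun_prop : Continuous fun y => x + y)).aestronglyMeasurable 1
      (Eventually.of_forall fun _ => hb1 _)
  have i3 : Integrable (fun y : Ed d => 2 / R * ‖y‖ ^ 2) G :=
    (integrable_sq_gaussMeasure hδ).const_mul _
  have hx : ∀ x : Ed d, ∫ y, min 1 (‖x + y‖ ^ 2 / R) ∂G
      ≤ min 1 (2 * ‖x‖ ^ 2 / R) + 2 * gaussConst d * (s - r) / R := by
    intro x
    calc ∫ y, min 1 (‖x + y‖ ^ 2 / R) ∂G
        ≤ ∫ y, (min 1 (2 * ‖x‖ ^ 2 / R) + 2 / R * ‖y‖ ^ 2) ∂G := by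
          refine integral_mono (i1 x) ((integrable_const _).add i3) fun y => ?_
          have h1 : ‖x + y‖ ^ 2 ≤ 2 * ‖x‖ ^ 2 + 2 * ‖y‖ ^ 2 := by
            have h := norm_add_le x y
            nlinarith [norm_nonneg (x + y), sq_nonneg (‖x‖ - ‖y‖)]
          have h2 : ‖x + y‖ ^ 2 / R ≤ 2 * ‖x‖ ^ 2 / R + 2 / R * ‖y‖ ^ 2 := by
            rw [div_mul_eq_mul_div, ← add_div]
            gcongr
          have h3 : 0 ≤ 2 / R * ‖y‖ ^ 2 := by positivity
          rcases min_cases 1 (2 * ‖x‖ ^ 2 / R) with ⟨h, -⟩ | ⟨h, -⟩ <;> simp only [h]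
          · exact (min_le_left _ _).trans (by linarith)
          · exact (min_le_right _ _).trans h2
      _ = min 1 (2 * ‖x‖ ^ 2 / R) + 2 / R * ∫ y, ‖y‖ ^ 2 ∂G := by
          rw [integral_add (integrable_const _) i3, integral_const_mul]
          simp
      _ ≤ min 1 (2 * ‖x‖ ^ 2 / R) + 2 / R * (gaussConst d * (s - r)) := by
          gcongr
          exact integral_sq_gaussMeasure_le hδ
      _ = _ := by ring
  have i2 : Integrable (fun x => ∫ y, min 1 (‖x + y‖ ^ 2 / R) ∂G) μ := by
    refine Integrable.of_bound (C := 1) ?_ (Eventually.of_forall fun x => ?_)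
    · exact (hcont1.comp (by fun_prop : Continuous fun q : Ed d × Ed d => q.1 + q.2)
        ).stronglyMeasurable.integral_prod_right'.aestronglyMeasurable
    · exact abs_integral_le_of_abs_le fun y => hb1 (x + y)
  calc ∫ x, ∫ y, min 1 (‖x + y‖ ^ 2 / R) ∂G ∂μ
      ≤ ∫ x, (min 1 (2 * ‖x‖ ^ 2 / R) + 2 * gaussConst d * (s - r) / R) ∂μ :=
        integral_mono i2 ((hinteg 2 zero_le_two).add (integrable_const _)) hx
    _ = _ := by
        rw [integral_add (hinteg 2 zero_le_two) (integrable_const _)]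
        simp

end Gaussian

/-! ### Time regularity of measure-valued processes -/

section TimeRegularity

attribute [local instance] MVP.mΩ MVP.probP

variable {d : ℕ} {t T : ℝ} {m : Measure (Ed d)}

lemma measurable_integral_of_continuous {φ : Ed d → ℝ} (hφ : Continuous φ) :
    Measurable fun μ : Measure (Ed d) => ∫ x, φ x ∂μ :=
  (StronglyMeasurable.integral_kernel
    (κ := (⟨id, measurable_id⟩ : ProbabilityTheory.Kernel (Measure (Ed d)) (Ed d)))
    hφ.stronglyMeasurable).measurable

namespace MVP

variable (X : MVP d T t m)

lemma genFiltration_le (s : ℝ) : genFiltration d X.M t s ≤ X.mΩ :=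
  iInf₂_le_of_le (s + 1) (by simp) (iSup₂_le fun r _ => (X.meas r).comap_le)

lemma measurable_genFiltration {s : ℝ} (hs : t ≤ s) :
    Measurable[genFiltration d X.M t s] (X.M s) :=
  measurable_iff_comap_le.2 <| le_iInf₂ fun _ hu =>
    le_iSup₂_of_le s ⟨hs, (mem_Ioi.1 hu).le⟩ le_rfl

variable {X}

lemma abs_integral_le {s : ℝ} (hs : s ∈ Icc t T) {φ : Ed d → ℝ} {C : ℝ} (hb : ∀ x, |φ x| ≤ C)
    (ω : X.Ω) : |∫ x, φ x ∂(X.M s ω)| ≤ C := by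
  have := (X.inP1 s hs ω).1
  exact abs_integral_le_of_abs_le hb

variable (X)

lemma integrable_integral {s : ℝ} (hs : s ∈ Icc t T) {φ : Ed d → ℝ} (hφ : Continuous φ) {C : ℝ}
    (hb : ∀ x, |φ x| ≤ C) : Integrable (fun ω => ∫ x, φ x ∂(X.M s ω)) X.P :=
  .of_bound ((measurable_integral_of_continuous hφ).comp (X.meas s)).aestronglyMeasurable C
    (Eventually.of_forall fun _ => abs_integral_le hs hb _)

lemma condExp_eq {r s : ℝ} (hr : t ≤ r) (hrs : r ≤ s) (hs : s ≤ T) {φ : Ed d → ℝ}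
    (hφ : Continuous φ) {C : ℝ} (hb : ∀ x, |φ x| ≤ C) :
    X.P[(fun ω => ∫ x, φ x ∂(X.M s ω)) | genFiltration d X.M t r]
      =ᵐ[X.P] fun ω => ∫ x, φ x ∂(heatFlow d r s (X.M r ω)) :=
  X.cond r s hr hrs hs (BoundedContinuousFunction.ofNormedAddCommGroup φ hφ C hb)

/-- The second moment of `M_s(φ)`. -/
def secondMoment (φ : Ed d → ℝ) (s : ℝ) : ℝ := ∫ ω, (∫ x, φ x ∂(X.M s ω)) ^ 2 ∂X.P

/-- Mean square increments are controlled by the increments of the second moment. -/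
lemma integral_sq_sub_le {r s : ℝ} (hr : t ≤ r) (hrs : r ≤ s) (hs : s ≤ T) {φ : Ed d → ℝ}
    (hφ : Continuous φ) {C : ℝ} (hC : 0 ≤ C) (hb : ∀ x, |φ x| ≤ C)
    (hl : ∀ x y, |φ x - φ y| ≤ C * ‖x - y‖) :
    ∫ ω, (∫ x, φ x ∂(X.M s ω) - ∫ x, φ x ∂(X.M r ω)) ^ 2 ∂X.P
      ≤ X.secondMoment φ s - X.secondMoment φ r
        + 2 * C ^ 2 * (gaussConst d + 1) * √(s - r) := by
  have hr' : r ∈ Icc t T := ⟨hr, hrs.trans hs⟩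
  have hs' : s ∈ Icc t T := ⟨hr.trans hrs, hs⟩
  set U := fun ω => ∫ x, φ x ∂(X.M s ω) with hU
  set V := fun ω => ∫ x, φ x ∂(X.M r ω) with hV
  set W := fun ω => ∫ x, φ x ∂(heatFlow d r s (X.M r ω)) with hW
  have mU : Measurable U := (measurable_integral_of_continuous hφ).comp (X.meas s)
  have mV : Measurable V := (measurable_integral_of_continuous hφ).comp (X.meas r)
  have bU : ∀ ω, |U ω| ≤ C := abs_integral_le hs' hb
  have bV : ∀ ω, |V ω| ≤ C := abs_integral_le hr' hb
  have iU : Integrable U X.P := X.integrable_integral hs' hφ hb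
  have iVmul : ∀ {g : X.Ω → ℝ}, Integrable g X.P → Integrable (fun ω => V ω * g ω) X.P :=
    fun hg => hg.bdd_mul mV.aestronglyMeasurable (Eventually.of_forall bV)
  have iV : Integrable V X.P := X.integrable_integral hr' hφ hb
  have iUU : Integrable (fun ω => U ω ^ 2) X.P := by
    simp only [sq]
    exact iU.bdd_mul mU.aestronglyMeasurable (Eventually.of_forall bU)
  have iVV : Integrable (fun ω => V ω ^ 2) X.P := by
    simp only [sq]
    exact iVmul iV
  have hcond : X.P[U | genFiltration d X.M t r] =ᵐ[X.P] W := X.condExp_eq hr hrs hs hφ hb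
  have iW : Integrable W X.P := integrable_condExp.congr hcond
  have hVm : StronglyMeasurable[genFiltration d X.M t r] V :=
    ((measurable_integral_of_continuous hφ).comp
      (X.measurable_genFiltration hr)).stronglyMeasurable
  have hUV : ∫ ω, V ω * U ω ∂X.P = ∫ ω, V ω * W ω ∂X.P := by
    have h1 := integral_condExp (μ := X.P) (f := V * U) (X.genFiltration_le r)
    have h2 := condExp_mul_of_stronglyMeasurable_left (μ := X.P) hVm (iVmul iU) iU
    have h3 : ∫ ω, (V * U) ω ∂X.P = ∫ ω, V ω * U ω ∂X.P := rfl
    rw [← h3, ← h1]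
    refine integral_congr_ae ?_
    filter_upwards [h2, hcond] with ω hω hω'
    rw [hω, Pi.mul_apply, hω']
  have hVW : ∀ ω, V ω * V ω - V ω * W ω ≤ C ^ 2 * (gaussConst d + 1) * √(s - r) := by
    intro ω
    have := (X.inP1 r hr' ω).1
    have h1 : |W ω - V ω| ≤ C * (gaussConst d + 1) * √(s - r) :=
      abs_integral_heatFlow_sub_le hrs (X.M r ω) hφ hC hb hl
    calc V ω * V ω - V ω * W ω = V ω * (V ω - W ω) := by ring
      _ ≤ |V ω * (V ω - W ω)| := le_abs_self _
      _ = |V ω| * |W ω - V ω| := by rw [abs_mul, abs_sub_comm]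
      _ ≤ C * (C * (gaussConst d + 1) * √(s - r)) := by
          gcongr
          exact bV ω
      _ = _ := by ring
  have hI : ∫ ω, V ω * V ω ∂X.P - ∫ ω, V ω * W ω ∂X.P
      ≤ C ^ 2 * (gaussConst d + 1) * √(s - r) := by
    rw [← integral_sub (iVmul iV) (iVmul iW)]
    refine (integral_mono ((iVmul iV).sub (iVmul iW)) (integrable_const _) hVW).trans_eq ?_
    simp
  have hexp : ∫ ω, (U ω - V ω) ^ 2 ∂X.P
      = ∫ ω, U ω ^ 2 ∂X.P - 2 * ∫ ω, V ω * U ω ∂X.P + ∫ ω, V ω ^ 2 ∂X.P := by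
    have i3 : Integrable (fun ω => U ω ^ 2 - 2 * (V ω * U ω)) X.P :=
      iUU.sub ((iVmul iU).const_mul 2)
    rw [← integral_const_mul, ← integral_sub iUU ((iVmul iU).const_mul 2),
      ← integral_add i3 iVV]
    congr 1
    funext ω
    ring
  have hsq : ∫ ω, V ω ^ 2 ∂X.P = ∫ ω, V ω * V ω ∂X.P := by simp only [sq]
  change ∫ ω, (U ω - V ω) ^ 2 ∂X.P ≤ ∫ ω, U ω ^ 2 ∂X.P - ∫ ω, V ω ^ 2 ∂X.P + _
  rw [hexp, hUV, hsq]
  linarith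

/-- Uniform tightness of the processes in `𝓜(t,m)`. -/
lemma integral_tail_le (hm : MemP d 2 m) {s R : ℝ} (hs : s ∈ Icc t T) (hR : 0 < R) :
    ∫ ω, (∫ x, min 1 (‖x‖ ^ 2 / R) ∂(X.M s ω)) ∂X.P
      ≤ (2 * ∫ x, ‖x‖ ^ 2 ∂m + 2 * gaussConst d * (T - t)) / R := by
  have := hm.1
  have ht' : t ∈ Icc t T := ⟨le_rfl, hs.1.trans hs.2⟩
  have hc1 : Continuous fun x : Ed d => min 1 (‖x‖ ^ 2 / R) := by fun_prop
  have hc2 : Continuous fun x : Ed d => min 1 (2 * ‖x‖ ^ 2 / R) := by fun_prop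
  have hb1 : ∀ x : Ed d, |min 1 (‖x‖ ^ 2 / R)| ≤ 1 := fun x => by
    rw [abs_of_nonneg (le_min zero_le_one (by positivity))]
    exact min_le_left _ _
  have hb2 : ∀ x : Ed d, |min 1 (2 * ‖x‖ ^ 2 / R)| ≤ 1 := fun x => by
    rw [abs_of_nonneg (le_min zero_le_one (by positivity))]
    exact min_le_left _ _
  have hcond := X.condExp_eq le_rfl hs.1 hs.2 hc1 hb1
  have hm2 : Integrable (fun x => ‖x‖ ^ 2) m := by simpa using hm.2
  have i2 := X.integrable_integral ht' hc2 hb2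
  have hg := gaussConst_nonneg d
  have hinit : ∫ ω, (∫ x, min 1 (2 * ‖x‖ ^ 2 / R) ∂(X.M t ω)) ∂X.P
      = ∫ x, min 1 (2 * ‖x‖ ^ 2 / R) ∂m :=
    X.init (BoundedContinuousFunction.ofNormedAddCommGroup _ hc2 1 hb2)
  calc ∫ ω, (∫ x, min 1 (‖x‖ ^ 2 / R) ∂(X.M s ω)) ∂X.P
      = ∫ ω, (∫ x, min 1 (‖x‖ ^ 2 / R) ∂(heatFlow d t s (X.M t ω))) ∂X.P := by
        rw [← integral_condExp (X.genFiltration_le t)]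
        exact integral_congr_ae hcond
    _ ≤ ∫ ω, (∫ x, min 1 (2 * ‖x‖ ^ 2 / R) ∂(X.M t ω)
          + 2 * gaussConst d * (s - t) / R) ∂X.P := by
        refine integral_mono (integrable_condExp.congr hcond) (i2.add (integrable_const _))
          fun ω => ?_
        have := (X.inP1 t ht' ω).1
        exact integral_heatFlow_tail_le hs.1 hR (X.M t ω)
    _ = ∫ x, min 1 (2 * ‖x‖ ^ 2 / R) ∂m + 2 * gaussConst d * (s - t) / R := by
        rw [integral_add i2 (integrable_const _), hinit]
        simp
    _ ≤ ∫ x, 2 / R * ‖x‖ ^ 2 ∂m + 2 * gaussConst d * (T - t) / R := by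
        have := hs.2
        refine add_le_add (integral_mono ?_ (hm2.const_mul _) fun x => ?_) (by gcongr)
        · exact .of_bound hc2.aestronglyMeasurable 1 (Eventually.of_forall hb2)
        · refine (min_le_right _ _).trans_eq ?_
          ring
    _ = _ := by
        rw [integral_const_mul]
        ring

lemma secondMoment_nonneg (φ : Ed d → ℝ) (s : ℝ) : 0 ≤ X.secondMoment φ s :=
  integral_nonneg fun _ => sq_nonneg _

lemma secondMoment_le {s : ℝ} (hs : s ∈ Icc t T) {φ : Ed d → ℝ} {C : ℝ}
    (hb : ∀ x, |φ x| ≤ C) : X.secondMoment φ s ≤ C ^ 2 := by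
  refine (le_abs_self _).trans (abs_integral_le_of_abs_le fun ω => ?_)
  rw [abs_pow]
  exact pow_le_pow_left₀ (abs_nonneg _) (abs_integral_le hs hb ω) 2

lemma measurable_secondMoment (htT : t ≤ T) {φ : Ed d → ℝ} (hφ : Continuous φ) {C : ℝ}
    (hC : 0 ≤ C) (hb : ∀ x, |φ x| ≤ C) (hl : ∀ x y, |φ x - φ y| ≤ C * ‖x - y‖) :
    Measurable fun s => X.secondMoment φ (clamp t T s) := by
  have h1 : Measurable fun p : ℝ × X.Ω => ∫ x, φ x ∂(X.M (clamp t T p.1) p.2) := by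
    refine measurable_uncurry_comp_clamp htT (Z := fun s ω => ∫ x, φ x ∂(X.M s ω))
      (fun s _ => (measurable_integral_of_continuous hφ).comp (X.meas s)) fun ω s hs => ?_
    refine (X.path ω).2.continuousWithinAt_of_abs_sub_le (C := C) (fun r hr s hs => ?_) hs
    refine (abs_integral_sub_integral_le_wdist hC hφ hb hl (X.inP1 r hr ω)
      (X.inP1 s hs ω)).trans ?_
    gcongr
    exact le_add_of_nonneg_right (abs_nonneg _)
  exact (StronglyMeasurable.integral_prod_right (ν := X.P)
    (f := fun s ω => (∫ x, φ x ∂(X.M (clamp t T s) ω)) ^ 2)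
    (h1.pow_const 2).stronglyMeasurable).measurable

end MVP

end TimeRegularity

/-! ### Uniform time regularity of the Hamiltonian along measure-valued processes -/

section Error

attribute [local instance] MVP.mΩ MVP.probP

variable {d : ℕ} {t T : ℝ} {m : Measure (Ed d)} {A B : Type} [MetricSpace A] [CompactSpace A]
  [Nonempty A] [MetricSpace B] [CompactSpace B] [Nonempty B] {f : ℝ → Ed d → A → B → ℝ} {C : ℝ}

/-- `S` indexes a finite `ε`-net of the costs `f s · u v`, uniformly on the ball of radius
`√R`. -/
def IsCostNet (f : ℝ → Ed d → A → B → ℝ) (t T R ε : ℝ) (S : Finset (ℝ × A × B)) : Prop :=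
  ∀ s ∈ Icc t T, ∀ u v, ∃ k ∈ S, ∀ x, ‖x‖ ≤ √R → |f s x u v - f k.1 x k.2.1 k.2.2| ≤ ε

namespace IsLipschitzCost

omit [Nonempty A] [Nonempty B] in
lemma exists_isCostNet (hf : IsLipschitzCost f C) (t T R : ℝ) {ε : ℝ} (hε : 0 < ε) :
    ∃ S, IsCostNet f t T R ε S := by
  have : CompactSpace (Metric.closedBall (0 : Ed d) √R) :=
    isCompact_iff_compactSpace.1 (isCompact_closedBall 0 √R)
  let F : C((ℝ × A × B) × Metric.closedBall (0 : Ed d) √R, ℝ) :=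
    ⟨fun q => f q.1.1 q.2 q.1.2.1 q.1.2.2, hf.cont.comp (by fun_prop :
      Continuous fun q : (ℝ × A × B) × Metric.closedBall (0 : Ed d) √R =>
        (q.1.1, (q.2 : Ed d), q.1.2.1, q.1.2.2))⟩
  have hK : IsCompact (Icc t T ×ˢ (univ : Set (A × B))) := isCompact_Icc.prod isCompact_univ
  obtain ⟨S, -, hS⟩ := hK.elim_nhds_subcover (fun p => F.curry ⁻¹' Metric.ball (F.curry p) ε)
    fun p _ => F.curry.continuous.continuousAt.preimage_mem_nhds (Metric.ball_mem_nhds _ hε)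
  refine ⟨S, fun s hs u v => ?_⟩
  obtain ⟨k, hk, hd⟩ := mem_iUnion₂.1 (hS (⟨hs, mem_univ (u, v)⟩ :
    (s, u, v) ∈ Icc t T ×ˢ (univ : Set (A × B))))
  refine ⟨k, hk, fun x hx => ?_⟩
  exact (ContinuousMap.dist_apply_le_dist (f := F.curry (s, u, v)) (g := F.curry k)
    (⟨x, by simpa using hx⟩ : Metric.closedBall (0 : Ed d) √R)).trans (Metric.mem_ball.1 hd).le

omit [CompactSpace A] [CompactSpace B] in
lemma abs_hamiltonian_sub_le_sum (hf : IsLipschitzCost f C) {R ε : ℝ} (hR : 0 < R)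
    {S : Finset (ℝ × A × B)} (hS : IsCostNet f t T R ε S) {r s : ℝ} (hs : s ∈ Icc t T)
    (μ ν : Measure (Ed d)) [IsProbabilityMeasure μ] [IsProbabilityMeasure ν] :
    |hamiltonian f s μ - hamiltonian f r ν|
      ≤ C * |s - r| + 2 * ε
        + 2 * C * (∫ x, min 1 (‖x‖ ^ 2 / R) ∂μ + ∫ x, min 1 (‖x‖ ^ 2 / R) ∂ν)
        + ∑ k ∈ S, |∫ x, f k.1 x k.2.1 k.2.2 ∂μ - ∫ x, f k.1 x k.2.1 k.2.2 ∂ν| := by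
  have hC := hf.nonneg
  refine hf.abs_hamiltonian_sub_le fun u v => ?_
  obtain ⟨k, hk, hx⟩ := hS s hs u v
  have hψ : ∀ x : Ed d, 0 ≤ min 1 (‖x‖ ^ 2 / R) := fun x => le_min zero_le_one (by positivity)
  have hpt : ∀ x, |f s x u v - f k.1 x k.2.1 k.2.2| ≤ ε + 2 * C * min 1 (‖x‖ ^ 2 / R) := by
    intro x
    by_cases h : ‖x‖ ≤ √R
    · have := mul_nonneg (mul_nonneg zero_le_two hC) (hψ x)
      linarith [hx x h]
    · have h1 : min 1 (‖x‖ ^ 2 / R) = 1 := by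
        rw [min_eq_left]
        rw [le_div_iff₀ hR, one_mul]
        exact (Real.sqrt_le_left (norm_nonneg x)).1 (not_le.1 h).le
      have hε : 0 ≤ ε := (abs_nonneg _).trans (hx 0 (by simp))
      have h2 := abs_sub (f s x u v) (f k.1 x k.2.1 k.2.2)
      rw [h1]
      linarith [hf.bdd s x u v, hf.bdd k.1 x k.2.1 k.2.2]
  have hone : ∀ (κ : Measure (Ed d)) [IsProbabilityMeasure κ],
      |∫ x, f s x u v ∂κ - ∫ x, f k.1 x k.2.1 k.2.2 ∂κ|
        ≤ ε + 2 * C * ∫ x, min 1 (‖x‖ ^ 2 / R) ∂κ := by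
    intro κ _
    have hi : Integrable (fun x : Ed d => min 1 (‖x‖ ^ 2 / R)) κ := by
      refine .of_bound (by fun_prop) 1 (Eventually.of_forall fun x => ?_)
      rw [Real.norm_of_nonneg (hψ x)]
      exact min_le_left _ _
    rw [← integral_sub (hf.integrable _ _ _ _) (hf.integrable _ _ _ _)]
    calc |∫ x, (f s x u v - f k.1 x k.2.1 k.2.2) ∂κ|
        ≤ ∫ x, |f s x u v - f k.1 x k.2.1 k.2.2| ∂κ := abs_integral_le_integral_abs
      _ ≤ ∫ x, (ε + 2 * C * min 1 (‖x‖ ^ 2 / R)) ∂κ :=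
          integral_mono ((hf.integrable _ _ _ _).sub (hf.integrable _ _ _ _)).abs
            ((integrable_const _).add (hi.const_mul _)) hpt
      _ = _ := by
          rw [integral_add (integrable_const _) (hi.const_mul _), integral_const_mul]
          simp
  have h1 := abs_le.1 (hone μ)
  have h2 := abs_le.1 (hone ν)
  have h3 := abs_le.1 (hf.abs_integral_sub_time_le s r u v ν)
  have h4 := Finset.single_le_sum (s := S)
    (f := fun k => |∫ x, f k.1 x k.2.1 k.2.2 ∂μ - ∫ x, f k.1 x k.2.1 k.2.2 ∂ν|)
    (fun _ _ => abs_nonneg _) hk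
  have h5 := abs_le.1 h4
  rw [abs_le]
  constructor <;> linarith

omit [CompactSpace A] [CompactSpace B] [Nonempty A] [Nonempty B] in
lemma integral_abs_sub_le (hf : IsLipschitzCost f C) (hC : 0 ≤ C) (X : MVP d T t m) {r s : ℝ}
    (hr : t ≤ r) (hrs : r ≤ s) (hs : s ≤ T) {η : ℝ} (hη : 0 < η) (k : ℝ × A × B) :
    ∫ ω, |∫ x, f k.1 x k.2.1 k.2.2 ∂(X.M s ω) - ∫ x, f k.1 x k.2.1 k.2.2 ∂(X.M r ω)| ∂X.P
      ≤ η + (X.secondMoment (fun x => f k.1 x k.2.1 k.2.2) s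
        - X.secondMoment (fun x => f k.1 x k.2.1 k.2.2) r
        + 2 * C ^ 2 * (gaussConst d + 1) * √(s - r)) / η := by
  have hc := hf.continuous_space k.1 k.2.1 k.2.2
  have hb : ∀ x, |f k.1 x k.2.1 k.2.2| ≤ C := fun x => hf.bdd _ _ _ _
  have i1 := (X.integrable_integral ⟨hr.trans hrs, hs⟩ hc hb).sub
    (X.integrable_integral ⟨hr, hrs.trans hs⟩ hc hb)
  have i2 : Integrable (fun ω => (∫ x, f k.1 x k.2.1 k.2.2 ∂(X.M s ω)
      - ∫ x, f k.1 x k.2.1 k.2.2 ∂(X.M r ω)) ^ 2) X.P := by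
    simp only [sq]
    refine i1.bdd_mul (c := 2 * C) i1.aestronglyMeasurable (Eventually.of_forall fun ω => ?_)
    have h1 := MVP.abs_integral_le (X := X) ⟨hr.trans hrs, hs⟩ hb ω
    have h2 := MVP.abs_integral_le (X := X) ⟨hr, hrs.trans hs⟩ hb ω
    refine (abs_sub _ _).trans ?_
    linarith
  have h := X.integral_sq_sub_le hr hrs hs hc hC hb (hf.lip_space _ _ _)
  calc _ ≤ ∫ ω, (η + (∫ x, f k.1 x k.2.1 k.2.2 ∂(X.M s ω)
      - ∫ x, f k.1 x k.2.1 k.2.2 ∂(X.M r ω)) ^ 2 / η) ∂X.P := by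
        refine integral_mono i1.abs ((integrable_const _).add (i2.div_const _)) fun ω => ?_
        exact (norm_le_sq_div_add hη _).trans_eq (add_comm _ _)
    _ = η + (∫ ω, (∫ x, f k.1 x k.2.1 k.2.2 ∂(X.M s ω)
      - ∫ x, f k.1 x k.2.1 k.2.2 ∂(X.M r ω)) ^ 2 ∂X.P) / η := by
        rw [integral_add (integrable_const _) (i2.div_const _), integral_div]
        simp
    _ ≤ _ := by gcongr

lemma integral_abs_hamiltonian_sub_le (hf : IsLipschitzCost f C) (hm : MemP d 2 m)
    (X : MVP d T t m) {R ε η : ℝ} (hR : 0 < R) (hη : 0 < η) {S : Finset (ℝ × A × B)}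
    (hS : IsCostNet f t T R ε S) {r s : ℝ} (hr : t ≤ r) (hrs : r ≤ s) (hs : s ≤ T) :
    ∫ ω, |hamiltonian f s (X.M s ω) - hamiltonian f r (X.M r ω)| ∂X.P
      ≤ C * (s - r) + 2 * ε
        + 4 * C * ((2 * ∫ x, ‖x‖ ^ 2 ∂m + 2 * gaussConst d * (T - t)) / R)
        + ∑ k ∈ S, (η + (X.secondMoment (fun x => f k.1 x k.2.1 k.2.2) s
          - X.secondMoment (fun x => f k.1 x k.2.1 k.2.2) r
          + 2 * C ^ 2 * (gaussConst d + 1) * √(s - r)) / η) := by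
  have hC := hf.nonneg
  have hs' : s ∈ Icc t T := ⟨hr.trans hrs, hs⟩
  have hr' : r ∈ Icc t T := ⟨hr, hrs.trans hs⟩
  have hH : ∀ {q : ℝ}, q ∈ Icc t T → Integrable (fun ω => hamiltonian f q (X.M q ω)) X.P :=
    fun {q} hq => .of_bound (hf.measurable_hamiltonian q (X.meas q)
      fun ω => (X.inP1 q hq ω).1).aestronglyMeasurable C (Eventually.of_forall fun ω => by
        have := (X.inP1 q hq ω).1
        exact hf.abs_hamiltonian_le q _)
  have hψc : Continuous fun x : Ed d => min 1 (‖x‖ ^ 2 / R) := by fun_prop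
  have hψb : ∀ x : Ed d, |min 1 (‖x‖ ^ 2 / R)| ≤ 1 := fun x => by
    rw [abs_of_nonneg (le_min zero_le_one (by positivity))]
    exact min_le_left _ _
  have iψ : Integrable (fun ω => 2 * C * (∫ x, min 1 (‖x‖ ^ 2 / R) ∂(X.M s ω)
      + ∫ x, min 1 (‖x‖ ^ 2 / R) ∂(X.M r ω))) X.P := ((X.integrable_integral hs' hψc hψb).add
    (X.integrable_integral hr' hψc hψb)).const_mul (2 * C)
  have ik : ∀ k ∈ S, Integrable (fun ω => |∫ x, f k.1 x k.2.1 k.2.2 ∂(X.M s ω)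
      - ∫ x, f k.1 x k.2.1 k.2.2 ∂(X.M r ω)|) X.P := fun k _ =>
    ((X.integrable_integral hs' (hf.continuous_space k.1 k.2.1 k.2.2)
      fun x => hf.bdd _ _ _ _).sub (X.integrable_integral hr'
        (hf.continuous_space k.1 k.2.1 k.2.2) fun x => hf.bdd _ _ _ _)).abs
  have t1 := X.integral_tail_le hm hs' hR
  have t2 := X.integral_tail_le hm hr' hR
  calc _ ≤ ∫ ω, (C * (s - r) + 2 * ε
        + 2 * C * (∫ x, min 1 (‖x‖ ^ 2 / R) ∂(X.M s ω) + ∫ x, min 1 (‖x‖ ^ 2 / R) ∂(X.M r ω))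
        + ∑ k ∈ S, |∫ x, f k.1 x k.2.1 k.2.2 ∂(X.M s ω)
          - ∫ x, f k.1 x k.2.1 k.2.2 ∂(X.M r ω)|) ∂X.P := by
        refine integral_mono ((hH hs').sub (hH hr')).abs
          (((integrable_const _).add iψ).add (integrable_finsetSum _ ik)) fun ω => ?_
        have := (X.inP1 s hs' ω).1
        have := (X.inP1 r hr' ω).1
        have h := hf.abs_hamiltonian_sub_le_sum hR hS (r := r) hs' (X.M s ω) (X.M r ω)
        rwa [abs_of_nonneg (sub_nonneg.2 hrs)] at h
    _ = C * (s - r) + 2 * ε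
        + 2 * C * (∫ ω, ∫ x, min 1 (‖x‖ ^ 2 / R) ∂(X.M s ω) ∂X.P
          + ∫ ω, ∫ x, min 1 (‖x‖ ^ 2 / R) ∂(X.M r ω) ∂X.P)
        + ∑ k ∈ S, ∫ ω, |∫ x, f k.1 x k.2.1 k.2.2 ∂(X.M s ω)
          - ∫ x, f k.1 x k.2.1 k.2.2 ∂(X.M r ω)| ∂X.P := by
        have i0 : Integrable (fun ω => C * (s - r) + 2 * ε
          + 2 * C * (∫ x, min 1 (‖x‖ ^ 2 / R) ∂(X.M s ω)
            + ∫ x, min 1 (‖x‖ ^ 2 / R) ∂(X.M r ω))) X.P := (integrable_const _).add iψ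
        rw [integral_add i0 (integrable_finsetSum _ ik), integral_finsetSum _ ik,
          integral_add (integrable_const _) iψ, integral_const_mul,
          integral_add (X.integrable_integral hs' hψc hψb) (X.integrable_integral hr' hψc hψb)]
        simp
    _ ≤ _ := by
        refine add_le_add ?_ (Finset.sum_le_sum fun k _ =>
          hf.integral_abs_sub_le hC X hr hrs hs hη k)
        have := mul_le_mul_of_nonneg_left (add_le_add t1 t2) (by positivity : 0 ≤ 2 * C)
        linarith

end IsLipschitzCost

lemma setIntegral_sub_shift_le (htT : t ≤ T) {b : ℝ → ℝ} (hb : Measurable b) {c : ℝ}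
    (h0 : ∀ s, 0 ≤ b s) (hc : ∀ s, b s ≤ c) {h : ℝ} (hh : 0 ≤ h) :
    ∫ s in Icc t T, (b s - b (s - h)) ≤ c * h := by
  have hi : ∀ x y : ℝ, IntervalIntegrable b volume x y := fun x y => by
    rw [intervalIntegrable_iff]
    refine Measure.integrableOn_of_bounded (M := c) (by simp) hb.aestronglyMeasurable
      (Eventually.of_forall fun s => ?_)
    rw [Real.norm_of_nonneg (h0 s)]
    exact hc s
  have hi' : IntervalIntegrable (fun s => b (s - h)) volume t T := by
    simpa using (hi (t - h) (T - h)).comp_sub_right h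
  rw [integral_Icc_eq_integral_Ioc, ← intervalIntegral.integral_of_le htT,
    intervalIntegral.integral_sub (hi _ _) hi', intervalIntegral.integral_comp_sub_right]
  have e1 := intervalIntegral.integral_add_adjacent_intervals (hi (t - h) t) (hi t T)
  have e2 := intervalIntegral.integral_add_adjacent_intervals (hi (t - h) (T - h)) (hi (T - h) T)
  have e3 : 0 ≤ ∫ s in (t - h)..t, b s :=
    intervalIntegral.integral_nonneg (by linarith) fun s _ => h0 s
  have e4 : ∫ s in (T - h)..T, b s ≤ c * h := by
    refine (intervalIntegral.integral_mono_on (by linarith) (hi _ _)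
      intervalIntegrable_const fun s _ => hc s).trans_eq ?_
    rw [intervalIntegral.integral_const, smul_eq_mul]
    ring
  linarith

end Error

/-! ### Time discretization -/

section Discretization

attribute [local instance] MVP.mΩ MVP.probP

variable {d : ℕ} {t T : ℝ} {m : Measure (Ed d)} {A B : Type} [MetricSpace A] [CompactSpace A]
  [Nonempty A] [MetricSpace B] [CompactSpace B] [Nonempty B] {f : ℝ → Ed d → A → B → ℝ} {C : ℝ}

namespace IsLipschitzCost

/-- A shifted form of the time regularity estimate, whose right-hand side is a telescoping
function of `s` up to small terms. -/
lemma integral_abs_hamiltonian_sub_le_shift (hf : IsLipschitzCost f C) (hm : MemP d 2 m)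
    (X : MVP d T t m) {R ε η : ℝ} (hR : 0 < R) (hη : 0 < η) {S : Finset (ℝ × A × B)}
    (hS : IsCostNet f t T R ε S) {b : ℝ × A × B → ℝ → ℝ}
    (hb : b = fun k s => (Ici t).indicator
      (fun s => X.secondMoment (fun x => f k.1 x k.2.1 k.2.2) (clamp t T s)) s)
    {r s h : ℝ} (hr : t ≤ r) (hrs : r ≤ s) (hs : s ≤ T) (hh : s - r ≤ h) :
    ∫ ω, |hamiltonian f s (X.M s ω) - hamiltonian f r (X.M r ω)| ∂X.P
      ≤ C * h + 2 * ε
        + 4 * C * ((2 * ∫ x, ‖x‖ ^ 2 ∂m + 2 * gaussConst d * (T - t)) / R)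
        + ∑ k ∈ S, (η + (b k s - b k (s - h)
          + 4 * C ^ 2 * (gaussConst d + 1) * √h) / η) := by
  have hC := hf.nonneg
  have hg := gaussConst_nonneg d
  refine (hf.integral_abs_hamiltonian_sub_le hm X hR hη hS hr hrs hs).trans ?_
  refine add_le_add (by gcongr) (Finset.sum_le_sum fun k _ => ?_)
  have h1 : b k s = X.secondMoment (fun x => f k.1 x k.2.1 k.2.2) s := by
    rw [hb]
    simp only
    rw [indicator_of_mem (mem_Ici.2 (hr.trans hrs)), clamp_eq ⟨hr.trans hrs, hs⟩]
  have h2 : b k (s - h) ≤ X.secondMoment (fun x => f k.1 x k.2.1 k.2.2) r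
      + 2 * C ^ 2 * (gaussConst d + 1) * √h := by
    rw [hb]
    simp only
    by_cases hsh : t ≤ s - h
    · rw [indicator_of_mem (mem_Ici.2 hsh), clamp_eq ⟨hsh, by linarith⟩]
      have h3 := X.integral_sq_sub_le hsh (by linarith : s - h ≤ r) (hrs.trans hs)
        (hf.continuous_space k.1 k.2.1 k.2.2) hC (fun x => hf.bdd _ _ _ _)
        (hf.lip_space k.1 k.2.1 k.2.2)
      have h4 : 0 ≤ ∫ ω, (∫ x, f k.1 x k.2.1 k.2.2 ∂(X.M r ω)
          - ∫ x, f k.1 x k.2.1 k.2.2 ∂(X.M (s - h) ω)) ^ 2 ∂X.P :=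
        integral_nonneg fun _ => sq_nonneg _
      have h5 : 2 * C ^ 2 * (gaussConst d + 1) * √(r - (s - h))
          ≤ 2 * C ^ 2 * (gaussConst d + 1) * √h := by
        gcongr
        linarith
      linarith
    · rw [indicator_of_notMem (by simpa using hsh)]
      have := X.secondMoment_nonneg (fun x => f k.1 x k.2.1 k.2.2) r
      positivity
  have h6 : 2 * C ^ 2 * (gaussConst d + 1) * √(s - r)
      ≤ 2 * C ^ 2 * (gaussConst d + 1) * √h := by gcongr
  refine add_le_add le_rfl (div_le_div_of_nonneg_right ?_ hη.le)
  linarith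

set_option maxHeartbeats 2000000 in
/-- Quantitative bound for the error made by evaluating the Hamiltonian at an earlier time. -/
lemma abs_integral_discretization_sub_le (hf : IsLipschitzCost f C) (htT : t ≤ T)
    (hm : MemP d 2 m) (X : MVP d T t m) {R ε η h : ℝ} (hR : 0 < R) (hη : 0 < η) (hh : 0 ≤ h)
    {S : Finset (ℝ × A × B)} (hS : IsCostNet f t T R ε S) {ρ : ℝ → ℝ} (hρ : Measurable ρ)
    (hρ' : ∀ s ∈ Icc t T, t ≤ ρ s ∧ ρ s ≤ s ∧ s - ρ s ≤ h) :
    |∫ ω, (∫ s in Icc t T, hamiltonian f (ρ s) (X.M (ρ s) ω)) ∂X.P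
        - ∫ ω, (∫ s in Icc t T, hamiltonian f s (X.M s ω)) ∂X.P|
      ≤ (T - t) * (C * h + 2 * ε
        + 4 * C * ((2 * ∫ x, ‖x‖ ^ 2 ∂m + 2 * gaussConst d * (T - t)) / R)
        + S.card * (η + 4 * C ^ 2 * (gaussConst d + 1) * √h / η))
        + S.card * (C ^ 2 * h / η) := by
  have hC := hf.nonneg
  set μ : Measure ℝ := volume.restrict (Icc t T) with hμ
  set b : ℝ × A × B → ℝ → ℝ := fun k s => (Ici t).indicator
      (fun s => X.secondMoment (fun x => f k.1 x k.2.1 k.2.2) (clamp t T s)) s with hb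
  set G : ℝ × X.Ω → ℝ := fun p =>
    hamiltonian f (clamp t T p.1) (X.M (clamp t T p.1) p.2) with hG
  have mG : Measurable G := hf.measurable_uncurry_hamiltonian htT X.measurable_path
  have bG : ∀ p, ‖G p‖ ≤ C := fun p => by
    have := (X.inP1 _ (clamp_mem htT p.1) p.2).1
    exact hf.abs_hamiltonian_le _ _
  have mG' : Measurable fun p : ℝ × X.Ω => G (ρ p.1, p.2) := mG.comp (by fun_prop)
  have iG : Integrable G (μ.prod X.P) :=
    .of_bound mG.aestronglyMeasurable C (Eventually.of_forall bG)
  have iG' : Integrable (fun p : ℝ × X.Ω => G (ρ p.1, p.2)) (μ.prod X.P) :=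
    .of_bound mG'.aestronglyMeasurable C (Eventually.of_forall fun p => bG _)
  have e1 : ∫ ω, (∫ s in Icc t T, hamiltonian f (ρ s) (X.M (ρ s) ω)) ∂X.P
      = ∫ p, G (ρ p.1, p.2) ∂(μ.prod X.P) := by
    rw [integral_prod_symm _ iG']
    congr 1
    funext ω
    refine setIntegral_congr_fun measurableSet_Icc fun s hs => ?_
    have := hρ' s hs
    simp only [hG, clamp_eq (⟨this.1, this.2.1.trans hs.2⟩ : ρ s ∈ Icc t T)]
  have e2 : ∫ ω, (∫ s in Icc t T, hamiltonian f s (X.M s ω)) ∂X.P = ∫ p, G p ∂(μ.prod X.P) := by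
    rw [integral_prod_symm _ iG]
    congr 1
    funext ω
    refine setIntegral_congr_fun measurableSet_Icc fun s hs => ?_
    simp only [hG, clamp_eq hs]
  have mb : ∀ k, Measurable (b k) := fun k =>
    (X.measurable_secondMoment htT (hf.continuous_space k.1 k.2.1 k.2.2) hC
      (fun x => hf.bdd _ _ _ _) (hf.lip_space k.1 k.2.1 k.2.2)).indicator measurableSet_Ici
  have b0 : ∀ k s, 0 ≤ b k s := fun k s =>
    indicator_nonneg (fun _ _ => X.secondMoment_nonneg _ _) _
  have bC : ∀ k s, b k s ≤ C ^ 2 := fun k s =>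
    indicator_apply_le' (fun _ => X.secondMoment_le (clamp_mem htT s) fun x => hf.bdd _ _ _ _)
      fun _ => by positivity
  have ib : ∀ k, Integrable (fun s => b k s - b k (s - h)) μ := fun k => by
    have h1 : Measurable fun s => b k (s - h) := (mb k).comp (by fun_prop)
    refine .of_bound ((mb k).sub h1).aestronglyMeasurable (C ^ 2)
      (Eventually.of_forall fun s => ?_)
    rw [Real.norm_eq_abs, abs_le]
    constructor <;> linarith [b0 k s, bC k s, b0 k (s - h), bC k (s - h)]
  set K : ℝ := C * h + 2 * ε
    + 4 * C * ((2 * ∫ x, ‖x‖ ^ 2 ∂m + 2 * gaussConst d * (T - t)) / R) with hK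
  set c : ℝ := 4 * C ^ 2 * (gaussConst d + 1) * √h with hc
  have ic : ∀ k, Integrable (fun s => (b k s - b k (s - h) + c) / η) μ := fun k =>
    ((ib k).add (integrable_const _)).div_const _
  have ik : ∀ k ∈ S, Integrable (fun s => η + (b k s - b k (s - h) + c) / η) μ := fun k _ =>
    (integrable_const _).add (ic k)
  have iabs := (iG.sub iG').abs
  have hvol : μ.real univ = T - t := by simp [hμ, Measure.real, Real.volume_Icc, htT]
  rw [abs_sub_comm, e1, e2, ← integral_sub iG iG']
  calc |∫ p, (G p - G (ρ p.1, p.2)) ∂(μ.prod X.P)|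
      ≤ ∫ p, |G p - G (ρ p.1, p.2)| ∂(μ.prod X.P) := abs_integral_le_integral_abs
    _ = ∫ s, (∫ ω, |G (s, ω) - G (ρ s, ω)| ∂X.P) ∂μ := integral_prod _ iabs
    _ ≤ ∫ s, (K + ∑ k ∈ S, (η + (b k s - b k (s - h) + c) / η)) ∂μ := by
        refine setIntegral_mono_on iabs.integral_prod_left
          ((integrable_const _).add (integrable_finsetSum _ ik)) measurableSet_Icc
          fun s hs => ?_
        obtain ⟨h1, h2, h3⟩ := hρ' s hs
        simp only [hG, clamp_eq hs, clamp_eq (⟨h1, h2.trans hs.2⟩ : ρ s ∈ Icc t T)]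
        exact hf.integral_abs_hamiltonian_sub_le_shift hm X hR hη hS hb h1 h2 hs.2 h3
    _ = (T - t) * K + ∑ k ∈ S, ((T - t) * (η + c / η)
          + (∫ s, (b k s - b k (s - h)) ∂μ) / η) := by
        rw [integral_add (integrable_const _) (integrable_finsetSum _ ik),
          integral_finsetSum _ ik, integral_const, hvol, smul_eq_mul]
        congr 1
        refine Finset.sum_congr rfl fun k _ => ?_
        rw [integral_add (integrable_const _) (ic k),
          integral_div, integral_add (ib k) (integrable_const _), integral_const, integral_const,
          hvol, smul_eq_mul, smul_eq_mul]
        ring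
    _ ≤ (T - t) * K + ∑ k ∈ S, ((T - t) * (η + c / η) + C ^ 2 * h / η) := by
        gcongr with k _
        exact setIntegral_sub_shift_le htT (mb k) (b0 k) (bC k) hh
    _ = _ := by
        rw [Finset.sum_const, nsmul_eq_mul]
        ring

/-- The Hamiltonian along a process of `𝓜(t,m)` can be evaluated at a slightly earlier time,
with an error which is uniform over `𝓜(t,m)`. -/
lemma exists_abs_integral_discretization_sub_le (hf : IsLipschitzCost f C) (htT : t ≤ T)
    (hm : MemP d 2 m) {ε : ℝ} (hε : 0 < ε) :
    ∃ h > 0, ∀ (X : MVP d T t m) (ρ : ℝ → ℝ), Measurable ρ →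
      (∀ s ∈ Icc t T, t ≤ ρ s ∧ ρ s ≤ s ∧ s - ρ s ≤ h) →
      |∫ ω, (∫ s in Icc t T, hamiltonian f (ρ s) (X.M (ρ s) ω)) ∂X.P
        - ∫ ω, (∫ s in Icc t T, hamiltonian f s (X.M s ω)) ∂X.P| < ε := by
  have hC := hf.nonneg
  have hL : 0 ≤ T - t := sub_nonneg.2 htT
  have hg := gaussConst_nonneg d
  set K : ℝ := 2 * ∫ x, ‖x‖ ^ 2 ∂m + 2 * gaussConst d * (T - t) with hK
  have hK0 : 0 ≤ K := by
    have : 0 ≤ ∫ x, ‖x‖ ^ 2 ∂m := integral_nonneg fun _ => by positivity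
    positivity
  set δ : ℝ := ε / (8 * (T - t + 1)) with hδ
  have hδ0 : 0 < δ := by positivity
  have hR : 0 < (4 * C * K + 1) / δ := by positivity
  have hKR : 4 * C * (K / ((4 * C * K + 1) / δ)) ≤ δ := by
    rw [div_div_eq_mul_div, ← mul_div_assoc, div_le_iff₀ (by positivity)]
    nlinarith
  obtain ⟨S, hS⟩ := hf.exists_isCostNet t T ((4 * C * K + 1) / δ) hδ0
  set η : ℝ := δ / (S.card + 1) with hη
  have hη0 : 0 < η := by positivity
  have hηS : S.card * η ≤ δ := by
    rw [hη, ← mul_div_assoc, div_le_iff₀ (by positivity)]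
    nlinarith
  set Q : ℝ → ℝ := fun h => (T - t) * (C * h + 2 * δ + 4 * C * (K / ((4 * C * K + 1) / δ))
      + S.card * (η + 4 * C ^ 2 * (gaussConst d + 1) * √h / η))
      + S.card * (C ^ 2 * h / η) with hQ
  have hQc : Continuous Q := by fun_prop
  have hQ0 : Q 0 < ε := by
    have h1 : Q 0 = (T - t) * (2 * δ + 4 * C * (K / ((4 * C * K + 1) / δ)) + S.card * η) := by
      simp [hQ]
    have h2 : δ * (8 * (T - t + 1)) = ε := div_mul_cancel₀ _ (by positivity)
    rw [h1]
    calc _ ≤ (T - t) * (2 * δ + δ + δ) := by gcongr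
      _ < ε := by nlinarith
  have hev : ∀ᶠ h in 𝓝[>] (0 : ℝ), Q h < ε :=
    nhdsWithin_le_nhds (hQc.continuousAt.eventually_lt_const hQ0)
  obtain ⟨h, hh, hh0⟩ := (hev.and self_mem_nhdsWithin).exists
  exact ⟨h, hh0, fun X ρ hρ hρ' => (hf.abs_integral_discretization_sub_le htT hm X hR hη0
    (mem_Ioi.1 hh0).le hS hρ hρ').trans_lt hh⟩

end IsLipschitzCost

end Discretization

section Partition

variable {n : ℕ} {τ : ℕ → ℝ}

lemma partition_le (hτ : ∀ q < n, τ q < τ (q + 1)) {j k : ℕ} (hjk : j ≤ k) (hk : k ≤ n) :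
    τ j ≤ τ k := by
  induction k, hjk using Nat.le_induction with
  | base => rfl
  | succ k _ ih => exact (ih (by lia)).trans (hτ k (by lia)).le

lemma exists_mem_Ico_partition {s : ℝ} (hs : s ∈ Ico (τ 0) (τ n)) :
    ∃ q < n, s ∈ Ico (τ q) (τ (q + 1)) := by
  induction n with
  | zero => exact absurd hs (by simp)
  | succ n ih =>
    by_cases h : s < τ n
    · obtain ⟨q, hq, h'⟩ := ih ⟨hs.1, h⟩
      exact ⟨q, by lia, h'⟩
    · exact ⟨n, by lia, not_lt.1 h, hs.2⟩

/-- The last point of the partition `τ 0 < ⋯ < τ n` before a given time. -/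
def lastPoint (n : ℕ) (τ : ℕ → ℝ) (s : ℝ) : ℝ :=
  (Finset.range (n + 1)).sup' Finset.nonempty_range_add_one fun q => if τ q ≤ s then τ q else τ 0

lemma measurable_lastPoint (n : ℕ) (τ : ℕ → ℝ) : Measurable (lastPoint n τ) :=
  Finset.measurable_range_sup'' fun _ _ =>
    Measurable.ite measurableSet_Ici measurable_const measurable_const

lemma lastPoint_eq (hτ : ∀ q < n, τ q < τ (q + 1)) {q : ℕ} (hq : q ≤ n) {s : ℝ} (hs : τ q ≤ s)
    (hs' : ∀ j ≤ n, τ j ≤ s → j ≤ q) : lastPoint n τ s = τ q := by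
  refine le_antisymm (Finset.sup'_le _ _ fun j hj => ?_) ?_
  · split_ifs with h
    · exact partition_le hτ (hs' j (by simpa [Nat.lt_succ_iff] using hj) h) hq
    · exact partition_le hτ (Nat.zero_le _) hq
  · refine (Finset.le_sup' _ (Finset.mem_range.2 (Nat.lt_succ_of_le hq))).trans' ?_
    rw [if_pos hs]

lemma lastPoint_eq_of_mem_Ico (hτ : ∀ q < n, τ q < τ (q + 1)) {q : ℕ} (hq : q < n) {s : ℝ}
    (hs : s ∈ Ico (τ q) (τ (q + 1))) : lastPoint n τ s = τ q :=
  lastPoint_eq hτ hq.le hs.1 fun _ hj hjs => not_lt.1 fun h =>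
    (hs.2.trans_le (partition_le hτ h hj)).not_ge hjs

lemma lastPoint_mem (hτ : ∀ q < n, τ q < τ (q + 1)) {h : ℝ} (hh : 0 ≤ h)
    (hmesh : ∀ q < n, τ (q + 1) - τ q ≤ h) {s : ℝ} (hs : s ∈ Icc (τ 0) (τ n)) :
    τ 0 ≤ lastPoint n τ s ∧ lastPoint n τ s ≤ s ∧ s - lastPoint n τ s ≤ h := by
  rcases hs.2.eq_or_lt with rfl | hlt
  · rw [lastPoint_eq hτ le_rfl le_rfl fun _ hj _ => hj]
    exact ⟨hs.1, le_rfl, by simpa using hh⟩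
  · obtain ⟨q, hq, hsq⟩ := exists_mem_Ico_partition ⟨hs.1, hlt⟩
    rw [lastPoint_eq_of_mem_Ico hτ hq hsq]
    exact ⟨partition_le hτ (Nat.zero_le _) hq.le, hsq.1, by linarith [hmesh q hq, hsq.2]⟩

/-- A Riemann sum is the integral of a step function. -/
lemma sum_partition_eq_integral_lastPoint (hτ : ∀ q < n, τ q < τ (q + 1)) (F : ℝ → ℝ) :
    ∑ q ∈ Finset.range n, (τ (q + 1) - τ q) * F (τ q)
      = ∫ s in Icc (τ 0) (τ n), F (lastPoint n τ s) := by
  have hcongr : ∀ q < n, EqOn (fun _ => F (τ q)) (fun s => F (lastPoint n τ s))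
      (Ioo (τ q) (τ (q + 1))) := fun q hq s hs => by
    simp only [lastPoint_eq_of_mem_Ico hτ hq (Ioo_subset_Ico_self hs)]
  have hinteg : ∀ q < n, IntervalIntegrable (fun s => F (lastPoint n τ s)) volume (τ q)
      (τ (q + 1)) := fun q hq => by
    rw [intervalIntegrable_iff_integrableOn_Ioo_of_le (hτ q hq).le]
    exact (integrableOn_const (by simp)).congr_fun (hcongr q hq) measurableSet_Ioo
  rw [integral_Icc_eq_integral_Ioc,
    ← intervalIntegral.integral_of_le (partition_le hτ (Nat.zero_le n) le_rfl),
    ← intervalIntegral.sum_integral_adjacent_intervals hinteg]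
  refine Finset.sum_congr rfl fun q hq => ?_
  have hq := Finset.mem_range.1 hq
  rw [intervalIntegral.integral_of_le (hτ q hq).le, integral_Ioc_eq_integral_Ioo,
    ← setIntegral_congr_fun measurableSet_Ioo (hcongr q hq), setIntegral_const, smul_eq_mul,
    Measure.real, Real.volume_Ioo, ENNReal.toReal_ofReal (sub_nonneg.2 (hτ q hq).le)]

end Partition

/-- Let `Mⁿ` be a sequence in `𝓜(t,m)` whose laws converge for `𝓛(κ₁)`
to the law of a process `M`, and let `πⁿ` be partitions of `[t,T]` with mesh `|πⁿ| → 0`.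
Then the Riemann sums converge:
`E[Σ_q (tⁿ_{q+1}−tⁿ_q) H(tⁿ_q, Mⁿ_{tⁿ_q})] → E[∫_t^T H(s,M_s) ds]`. -/
theorem riemann_sums_converge (d : ℕ) (T t : ℝ) (ht : 0 ≤ t) (htT : t ≤ T)
    {A B : Type} [MetricSpace A] [CompactSpace A] [Nonempty A]
    [MetricSpace B] [CompactSpace B] [Nonempty B]
    (f : ℝ → Ed d → A → B → ℝ) (C : ℝ)
    (hfbdd : ∀ t x u v, |f t x u v| ≤ C)
    (hfcont : Continuous fun q : ℝ × Ed d × A × B => f q.1 q.2.1 q.2.2.1 q.2.2.2)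
    (hflip : ∀ (u : A) (v : B), ∀ s s' : ℝ, ∀ x x' : Ed d,
      |f s x u v - f s' x' u v| ≤ C * (‖x - x'‖ + |s - s'|))
    (hIsaacs : ∀ s ∈ Set.Icc t T, ∀ μ : Measure (Ed d), MemP d 2 μ →
      (⨅ u : A, ⨆ v : B, ∫ x, f s x u v ∂μ) = ⨆ v : B, ⨅ u : A, ∫ x, f s x u v ∂μ)
    (m : Measure (Ed d)) (hm : MemP d 2 m)
    (Xseq : ℕ → MVP d T t m) (Y : MVP d T t m)
    -- convergence in law for `𝓛(κ₁)`
    (hconv : ∀ F : DPath d t T → ℝ, (∃ c : ℝ, ∀ g, |F g| ≤ c) →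
      (∀ g : DPath d t T, ∀ ε > (0:ℝ), ∃ η > (0:ℝ), ∀ g' : DPath d t T,
        distD d t T g g' < η → |F g' - F g| < ε) →
      Tendsto (fun n => ∫ g, F g ∂(Xseq n).law) atTop (𝓝 (∫ g, F g ∂Y.law)))
    -- the partitions `πⁿ` and their meshes
    (N : ℕ → ℕ) (τg : ℕ → ℕ → ℝ)
    (hN : ∀ n, 2 ≤ N n)
    (hτ0 : ∀ n, τg n 0 = t) (hτN : ∀ n, τg n (N n - 1) = T)
    (hτmono : ∀ n q, q + 1 < N n → τg n q < τg n (q + 1))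
    (hmesh : ∀ ε > (0:ℝ), ∃ n₀, ∀ n ≥ n₀, ∀ q, q + 1 < N n → τg n (q + 1) - τg n q < ε) :
    Tendsto (fun n => ∫ ω, (∑ q ∈ Finset.range (N n - 1),
        (τg n (q + 1) - τg n q) * hamiltonian f (τg n q) ((Xseq n).M (τg n q) ω))
        ∂(Xseq n).P)
      atTop (𝓝 (∫ ω, (∫ s in Set.Icc t T, hamiltonian f s (Y.M s ω)) ∂Y.P)) := by
  have hf : IsLipschitzCost f C := ⟨hfbdd, hfcont, hflip⟩
  have hlim := hf.tendsto_integral_integral_hamiltonian htT hconv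
  rw [Metric.tendsto_atTop] at hlim ⊢
  intro ε hε
  obtain ⟨h, hh, herr⟩ := hf.exists_abs_integral_discretization_sub_le htT hm (half_pos hε)
  obtain ⟨n₁, hn₁⟩ := hlim (ε / 2) (half_pos hε)
  obtain ⟨n₀, hn₀⟩ := hmesh h hh
  refine ⟨max n₀ n₁, fun n hn => ?_⟩
  have hmono : ∀ q < N n - 1, τg n q < τg n (q + 1) := fun q hq => hτmono n q (by lia)
  have hlt : ∀ q < N n - 1, τg n (q + 1) - τg n q ≤ h := fun q hq =>
    (hn₀ n (le_of_max_le_left hn) q (by lia)).le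
  have h1 := herr (Xseq n) _ (measurable_lastPoint (N n - 1) (τg n)) fun s hs => by
    have := lastPoint_mem hmono hh.le hlt (s := s) (by rwa [hτ0, hτN])
    rwa [hτ0] at this
  have h2 : ∀ ω, ∑ q ∈ Finset.range (N n - 1),
      (τg n (q + 1) - τg n q) * hamiltonian f (τg n q) ((Xseq n).M (τg n q) ω)
      = ∫ s in Icc t T, hamiltonian f (lastPoint (N n - 1) (τg n) s)
          ((Xseq n).M (lastPoint (N n - 1) (τg n) s) ω) := fun ω => by
    rw [sum_partition_eq_integral_lastPoint hmono
      (fun r => hamiltonian f r ((Xseq n).M r ω)), hτ0, hτN]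
  simp only [h2]
  refine (dist_triangle _ _ _).trans_lt ((add_lt_add h1 (hn₁ n (le_of_max_le_right hn))).trans_eq
    (add_halves ε))

end
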